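/- arXiv:1302.3060 — 2 statements merged into one kernel-verified Lean document; each statement's English description precedes it below -/
import Mathlib

section
/- Let χ₁, χ₂ : F^× → E^× be tamely ramified smooth characters (trivial on 1+πO_F) such that σ = Ind_B^G(χ₁,χ₂) is irreducible (i.e. χ₁/(ωχ₂) ≠ ω^{±1}), let m ∈ ℤ, n = 0, τ = det(·)^m, and set λ̃ = χ₁(π)π^m, μ̃ = ω(π)χ₂(π)π^m. If |λ̃μ̃q| = 1, |λ̃| ≤ |q^{-1}| and |μ̃| ≤ |q^{-1}|, then the locally algebraic representation ρ = τ ⊗ σ of G = GL₂(F) on V_τ ⊗_E V_σ (with diagonal action) admits an integral structure. -/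
open scoped Classical
open Matrix

noncomputable section

namespace BS

variable (E : Type) [Field E]

/-- The ring of integers of a subfield `F` of `E`, with respect to a nonarchimedean
absolute value on `E`, as an additive subgroup of `F`. -/
def OFadd (abs : AbsoluteValue E ℝ)
    (na : ∀ x y : E, abs (x + y) ≤ max (abs x) (abs y))
    (F : Subfield E) : AddSubgroup F where
  carrier := {x | abs (x : E) ≤ 1}
  zero_mem' := by simp
  add_mem' := by
    intro a b ha hb
    simp only [Set.mem_setOf_eq] at *
    have h : ((a + b : F) : E) = (a : E) + (b : E) := by push_cast; ring
    rw [h]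
    exact le_trans (na _ _) (max_le ha hb)
  neg_mem' := by
    intro a ha
    simp only [Set.mem_setOf_eq] at *
    have h : ((-a : F) : E) = -(a : E) := by push_cast; ring
    rw [h, abs.map_neg]
    exact ha

/-- `W = F/O_F`. -/
abbrev Wq (abs : AbsoluteValue E ℝ)
    (na : ∀ x y : E, abs (x + y) ≤ max (abs x) (abs y))
    (F : Subfield E) : Type := F ⧸ OFadd E abs na F

/-- The canonical projection `F → W = F/O_F`. -/
def mkW (abs : AbsoluteValue E ℝ)
    (na : ∀ x y : E, abs (x + y) ≤ max (abs x) (abs y))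
    (F : Subfield E) : F →+ Wq E abs na F := QuotientAddGroup.mk' _

/-- Multiplication by `π` on `W = F/O_F`. -/
def pmulW (abs : AbsoluteValue E ℝ)
    (na : ∀ x y : E, abs (x + y) ≤ max (abs x) (abs y))
    (F : Subfield E) (π : F) (hπ : abs (π : E) ≤ 1) :
    Wq E abs na F →+ Wq E abs na F :=
  QuotientAddGroup.map _ _ (AddMonoidHom.mulLeft π) (by
    intro x hx
    simp only [AddSubgroup.mem_comap, AddMonoidHom.coe_mulLeft]
    show abs ((π * x : F) : E) ≤ 1
    have h : ((π * x : F) : E) = (π : E) * (x : E) := by push_cast; ring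
    rw [h, abs.map_mul]
    have hx' : abs (x : E) ≤ 1 := hx
    nlinarith [abs.nonneg (x : E), abs.nonneg (π : E)])


/-- Extension of a character `χ : F^× → E^×` to `F`, by `0` at `0`. -/
def extChar (F : Subfield E) (χ : Fˣ →* Eˣ) (x : F) : E :=
  if h : x = 0 then 0 else (χ (Units.mk0 x h) : E)

/-- A matrix over the subfield `F`, viewed over `E`. -/
def matE (F : Subfield E) (g : Matrix (Fin 2) (Fin 2) F) : Matrix (Fin 2) (Fin 2) E :=
  fun i j => (g i j : E)

/-- The rational representation `τ = det(·)^m ⊗ Sym^n` on `V_τ = E[u]^{≤n}`, realized on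
polynomials: `τ([[a,b],[c,d]])·u^i = (ad−bc)^m (a+cu)^{n−i} (b+du)^i`. -/
def tauPoly (m : ℤ) (n : ℕ) (g : Matrix (Fin 2) (Fin 2) E) (P : Polynomial E) :
    Polynomial E :=
  ((g 0 0 * g 1 1 - g 0 1 * g 1 0) ^ m) •
    ∑ i ∈ Finset.range (n + 1), P.coeff i •
      ((Polynomial.C (g 0 0) + Polynomial.C (g 1 0) * Polynomial.X) ^ (n - i) *
       (Polynomial.C (g 0 1) + Polynomial.C (g 1 1) * Polynomial.X) ^ i)

/-- Membership in `σ = Ind_B^G(χ₁,χ₂)`: `f : G → E` satisfies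
`f([[t₁,s],[0,t₂]]g) = χ₁(t₁)χ₂(t₂)f(g)` and is right-invariant under some (open) principal
congruence subgroup of `GL₂(O_F)`. -/
def IsIndFun (abs : AbsoluteValue E ℝ) (F : Subfield E) (π : F)
    (χ1 χ2 : Fˣ →* Eˣ) (f : GL (Fin 2) F → E) : Prop :=
  (∀ b : GL (Fin 2) F, (b : Matrix (Fin 2) (Fin 2) F) 1 0 = 0 →
    ∀ g : GL (Fin 2) F, f (b * g) =
      extChar E F χ1 ((b : Matrix (Fin 2) (Fin 2) F) 0 0) *
      extChar E F χ2 ((b : Matrix (Fin 2) (Fin 2) F) 1 1) * f g) ∧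
  (∃ N : ℕ, ∀ g h : GL (Fin 2) F,
    (∀ i j : Fin 2, abs ((((h : Matrix (Fin 2) (Fin 2) F) i j : F) : E) -
      (((1 : Matrix (Fin 2) (Fin 2) F) i j : F) : E)) ≤ abs (π : E) ^ N) →
    f (g * h) = f g)

/-- The locally algebraic representation `ρ = τ ⊗ σ` realized on functions
`G → V_τ = E[u]^{≤n}`: the element `v ⊗ f` of `V_τ ⊗_E V_σ` corresponds to the function
`g ↦ f(g)·v`, and `(ρ(g)Φ)(g′) = τ(g)(Φ(g′g))`. -/
def rhoAct (F : Subfield E) (m : ℤ) (n : ℕ)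
    (g : GL (Fin 2) F) (Φ : GL (Fin 2) F → Polynomial E) : GL (Fin 2) F → Polynomial E :=
  fun g' => tauPoly E m n (matE E F (g : Matrix (Fin 2) (Fin 2) F)) (Φ (g' * g))

/-- The space `V_ρ = V_τ ⊗_E V_σ`, realized as the span of the functions `g ↦ f(g)·v`
with `v ∈ E[u]^{≤n}` and `f ∈ V_σ`. -/
def Vrho (abs : AbsoluteValue E ℝ) (F : Subfield E) (π : F)
    (χ1 χ2 : Fˣ →* Eˣ) (n : ℕ) : Submodule E (GL (Fin 2) F → Polynomial E) :=
  Submodule.span E {Φ | ∃ (v : Polynomial E) (f : GL (Fin 2) F → E),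
    v.degree ≤ (n : WithBot ℕ) ∧ IsIndFun E abs F π χ1 χ2 f ∧ Φ = fun g => f g • v}

/-- The data entering the construction of an integral structure in a tamely ramified principal
series of `GL₂(F)` with coefficients in `E`, realised on functions on `F²` that are homogeneous of
weight `χ`, an element `g` acting by right translation and multiplication by `η (det g)`. The
finite set `R` represents the residue field of `F`. -/
structure TameDatum (F E : Type) [Field F] [Field E] where
  nF : AbsoluteValue F ℝ
  nE : AbsoluteValue E ℝ
  naF : ∀ x y, nF (x + y) ≤ max (nF x) (nF y)
  naE : ∀ x y, nE (x + y) ≤ max (nE x) (nE y)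
  π : F
  π_ne : π ≠ 0
  π_lt : nF π < 1
  disc : ∀ x : F, x ≠ 0 → ∃ k : ℤ, nF x = nF π ^ k
  R : Finset F
  R_le : ∀ s ∈ R, nF s ≤ 1
  R_inj : ∀ s ∈ R, ∀ s' ∈ R, nF (s - s') ≤ nF π → s = s'
  rep : F → F
  rep_mem : ∀ x, nF x ≤ 1 → rep x ∈ R
  rep_close : ∀ x, nF x ≤ 1 → nF (x - rep x) ≤ nF π
  χ : F →*₀ E
  η : F →*₀ E
  χ_unit : ∀ u, nF u = 1 → nE (χ u) = 1
  η_unit : ∀ u, nF u = 1 → nE (η u) = 1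
  χ_tame : ∀ u, nF (u - 1) ≤ nF π → χ u = 1
  one_le : 1 ≤ nE (η π)
  χ_π : nE (χ π) * nE (η π) ^ 2 = 1
  card_le : nE (R.card : E) * nE (η π) ≤ 1
  exists_one_lt : ∃ c, 1 < nE c

namespace TameDatum

variable {F E : Type} [Field F] [Field E] (D : TameDatum F E)

lemma π_pos : 0 < D.nF D.π := D.nF.pos D.π_ne

lemma nF_sub (x y : F) : D.nF (x - y) ≤ max (D.nF x) (D.nF y) := by
  simpa [sub_eq_add_neg] using D.naF x (-y)

lemma nF_add_le {x y : F} {r : ℝ} (hx : D.nF x ≤ r) (hy : D.nF y ≤ r) : D.nF (x + y) ≤ r :=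
  (D.naF x y).trans (max_le hx hy)

lemma nF_sub_le {x y : F} {r : ℝ} (hx : D.nF x ≤ r) (hy : D.nF y ≤ r) : D.nF (x - y) ≤ r :=
  (D.nF_sub x y).trans (max_le hx hy)

lemma nE_add_le {x y : E} {r : ℝ} (hx : D.nE x ≤ r) (hy : D.nE y ≤ r) : D.nE (x + y) ≤ r :=
  (D.naE x y).trans (max_le hx hy)

lemma nE_sum_le {ι : Type*} (s : Finset ι) (f : ι → E) {r : ℝ} (hr : 0 ≤ r)
    (h : ∀ i ∈ s, D.nE (f i) ≤ r) : D.nE (∑ i ∈ s, f i) ≤ r := by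
  induction s using Finset.induction_on with
  | empty => simpa using hr
  | insert a s ha ih =>
    rw [Finset.sum_insert ha]
    exact D.nE_add_le (h a (by simp)) (ih fun i hi => h i (by simp [hi]))

lemma nF_mul_le_one {x y : F} (hx : D.nF x ≤ 1) (hy : D.nF y ≤ 1) : D.nF (x * y) ≤ 1 := by
  rw [map_mul]; exact mul_le_one₀ hx (D.nF.nonneg _) hy

lemma nF_mul_le {x y : F} {r : ℝ} (hx : D.nF x ≤ 1) (hy : D.nF y ≤ r) : D.nF (x * y) ≤ r := by
  rw [map_mul]; exact (mul_le_of_le_one_left (D.nF.nonneg _) hx).trans hy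

lemma nF_mul_le' {x y : F} {r : ℝ} (hx : D.nF x ≤ r) (hy : D.nF y ≤ 1) : D.nF (x * y) ≤ r := by
  rw [mul_comm]; exact D.nF_mul_le hy hx

/-- The valuation is discrete. -/
lemma le_mul_of_lt {x y : F} (h : D.nF x < D.nF y) : D.nF x ≤ D.nF D.π * D.nF y := by
  rcases eq_or_ne x 0 with rfl | hx
  · simpa using mul_nonneg D.π_pos.le (D.nF.nonneg y)
  have hy : y ≠ 0 := by
    rintro rfl
    simp at h
    exact absurd (D.nF.nonneg x) (not_le.2 h)
  obtain ⟨k, hk⟩ := D.disc x hx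
  obtain ⟨l, hl⟩ := D.disc y hy
  rw [hk, hl] at h ⊢
  have hlk : l < k := (zpow_lt_zpow_iff_right_of_lt_one₀ D.π_pos D.π_lt).1 h
  rw [← zpow_one_add₀ D.π_pos.ne']
  exact zpow_le_zpow_right_of_le_one₀ D.π_pos D.π_lt.le (by omega)

lemma le_π_of_lt_one {x : F} (h : D.nF x < 1) : D.nF x ≤ D.nF D.π := by
  simpa using D.le_mul_of_lt (y := 1) (by simpa using h)

lemma nF_eq_of_sub_lt {x y : F} (h : D.nF (x - y) < D.nF y) : D.nF x = D.nF y := by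
  apply le_antisymm
  · have := D.naF (x - y) y
    rw [sub_add_cancel, max_eq_right h.le] at this
    exact this
  · by_contra hlt
    have h2 := D.nF_sub x (x - y)
    rw [sub_sub_cancel] at h2
    exact absurd h2 (not_le.2 (max_lt (not_le.1 hlt) h))

lemma χ_eq_of_close {x y : F} (hy : y ≠ 0) (h : D.nF (x - y) ≤ D.nF D.π * D.nF y) :
    D.χ x = D.χ y := by
  have h1 : D.χ (x / y) = 1 := by
    apply D.χ_tame
    rw [div_sub_one hy, map_div₀]
    exact (div_le_iff₀ (D.nF.pos hy)).2 h
  rw [map_div₀] at h1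
  exact (div_eq_one_iff_eq ((map_ne_zero D.χ).2 hy)).1 h1

/-- Absolute values of `χ` on integral elements are at most one. -/
lemma nE_χ_le_one {x : F} (hx : D.nF x ≤ 1) : D.nE (D.χ x) ≤ 1 := by
  rcases eq_or_ne x 0 with rfl | hx0
  · simp
  obtain ⟨k, hk⟩ := D.disc x hx0
  have hk0 : 0 ≤ k := by
    by_contra hneg
    rw [hk] at hx
    exact absurd hx (not_le.2 (one_lt_zpow_of_neg₀ D.π_pos D.π_lt (not_le.1 hneg)))
  have hχπ : D.nE (D.χ D.π) ≤ 1 := by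
    have h2 := D.one_le
    have h3 := D.χ_π
    have := D.nE.nonneg (D.χ D.π)
    nlinarith [mul_nonneg this (by nlinarith : (0:ℝ) ≤ D.nE (D.η D.π) ^ 2 - 1)]
  have hu : D.nF (x / D.π ^ k) = 1 := by
    rw [map_div₀, map_zpow₀, hk, div_self (zpow_pos D.π_pos k).ne']
  have hx' : x = x / D.π ^ k * D.π ^ k := by
    rw [div_mul_cancel₀ _ (zpow_ne_zero k D.π_ne)]
  rw [hx', map_mul, map_mul, D.χ_unit _ hu, one_mul]
  lift k to ℕ using hk0
  rw [zpow_natCast, map_pow, map_pow]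
  exact pow_le_one₀ (D.nE.nonneg _) hχπ

/-! ### Row vectors -/

/-- The maximum norm on `F²`. -/
def nV (v : F × F) : ℝ := max (D.nF v.1) (D.nF v.2)

lemma nV_nonneg (v : F × F) : 0 ≤ D.nV v := (D.nF.nonneg _).trans (le_max_left _ _)

lemma nV_smul (x : F) (v : F × F) : D.nV (x • v) = D.nF x * D.nV v := by
  simp [nV, mul_max_of_nonneg, D.nF.nonneg]

lemma nV_pos {v : F × F} (hv : v ≠ 0) : 0 < D.nV v := by
  by_contra h
  apply hv
  have h1 := max_le_iff.1 (not_lt.1 h)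
  exact Prod.ext (D.nF.eq_zero.1 (h1.1.antisymm (D.nF.nonneg _)))
    (D.nF.eq_zero.1 (h1.2.antisymm (D.nF.nonneg _)))

/-- Right multiplication of a row vector by a matrix. -/
def _root_.BS.rowMul (v : F × F) (g : Matrix (Fin 2) (Fin 2) F) : F × F :=
  (v.1 * g 0 0 + v.2 * g 1 0, v.1 * g 0 1 + v.2 * g 1 1)

lemma _root_.BS.rowMul_mul (v : F × F) (g g' : Matrix (Fin 2) (Fin 2) F) :
    rowMul v (g * g') = rowMul (rowMul v g) g' := by
  ext <;> simp [rowMul, Matrix.mul_apply, Fin.sum_univ_two] <;> ring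

lemma _root_.BS.rowMul_smul (x : F) (v : F × F) (g : Matrix (Fin 2) (Fin 2) F) :
    rowMul (x • v) g = x • rowMul v g := by
  ext <;> simp [rowMul] <;> ring

lemma _root_.BS.rowMul_sub (v w : F × F) (g : Matrix (Fin 2) (Fin 2) F) :
    rowMul (v - w) g = rowMul v g - rowMul w g := by
  ext <;> simp [rowMul] <;> ring

/-- The matrices in `GL₂(O_F)`. -/
def IsK (k : Matrix (Fin 2) (Fin 2) F) : Prop := (∀ i j, D.nF (k i j) ≤ 1) ∧ D.nF k.det = 1

lemma nV_rowMul_le {g : Matrix (Fin 2) (Fin 2) F} (hg : ∀ i j, D.nF (g i j) ≤ 1) (v : F × F) :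
    D.nV (rowMul v g) ≤ D.nV v :=
  max_le
    (D.nF_add_le (D.nF_mul_le' (le_max_left _ _) (hg _ _))
      (D.nF_mul_le' (le_max_right _ _) (hg _ _)))
    (D.nF_add_le (D.nF_mul_le' (le_max_left _ _) (hg _ _))
      (D.nF_mul_le' (le_max_right _ _) (hg _ _)))

lemma IsK.one : D.IsK 1 := by
  refine ⟨fun i j => ?_, by simp⟩
  fin_cases i <;> fin_cases j <;> simp

variable {D} in
lemma IsK.mul {k k' : Matrix (Fin 2) (Fin 2) F} (hk : D.IsK k) (hk' : D.IsK k') :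
    D.IsK (k * k') := by
  refine ⟨fun i j => ?_, by rw [Matrix.det_mul, map_mul, hk.2, hk'.2, one_mul]⟩
  rw [Matrix.mul_apply, Fin.sum_univ_two]
  exact D.nF_add_le (D.nF_mul_le_one (hk.1 _ _) (hk'.1 _ _))
    (D.nF_mul_le_one (hk.1 _ _) (hk'.1 _ _))

variable {D} in
lemma IsK.det_ne {k : Matrix (Fin 2) (Fin 2) F} (hk : D.IsK k) : k.det ≠ 0 := by
  intro h
  have := hk.2
  simp [h] at this

variable {D} in
lemma IsK.inv {k : Matrix (Fin 2) (Fin 2) F} (hk : D.IsK k) : D.IsK k⁻¹ := by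
  have hd : D.nF (k.det)⁻¹ = 1 := by rw [map_inv₀, hk.2, inv_one]
  refine ⟨fun i j => ?_, ?_⟩
  · rw [Matrix.inv_def, Ring.inverse_eq_inv', Matrix.smul_apply, smul_eq_mul, map_mul, hd, one_mul,
      Matrix.adjugate_fin_two]
    fin_cases i <;> fin_cases j <;> simp [hk.1]
  · rw [Matrix.det_nonsing_inv, Ring.inverse_eq_inv', hd]

variable {D} in
lemma IsK.mul_inv {k : Matrix (Fin 2) (Fin 2) F} (hk : D.IsK k) : k * k⁻¹ = 1 :=
  Matrix.mul_nonsing_inv _ (isUnit_iff_ne_zero.2 hk.det_ne)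

variable {D} in
lemma IsK.inv_mul {k : Matrix (Fin 2) (Fin 2) F} (hk : D.IsK k) : k⁻¹ * k = 1 :=
  Matrix.nonsing_inv_mul _ (isUnit_iff_ne_zero.2 hk.det_ne)

variable {D} in
lemma IsK.nV_rowMul {k : Matrix (Fin 2) (Fin 2) F} (hk : D.IsK k) (v : F × F) :
    D.nV (rowMul v k) = D.nV v := by
  apply le_antisymm (D.nV_rowMul_le hk.1 v)
  calc D.nV v = D.nV (rowMul (rowMul v k) k⁻¹) := by
        rw [← rowMul_mul, hk.mul_inv]; simp [rowMul]
    _ ≤ _ := D.nV_rowMul_le hk.inv.1 _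

/-- The matrix `diag(1, π ^ j)`. -/
def T (j : ℕ) : Matrix (Fin 2) (Fin 2) F := !![1, 0; 0, D.π ^ j]

lemma T_add (i j : ℕ) : D.T (i + j) = D.T i * D.T j := by
  simp [T, pow_add]

lemma det_T (j : ℕ) : (D.T j).det = D.π ^ j := by simp [T, Matrix.det_fin_two]

lemma rowMul_T (v : F × F) (j : ℕ) : rowMul v (D.T j) = (v.1, v.2 * D.π ^ j) := by
  simp [rowMul, T]

lemma pow_le_one' (j : ℕ) : D.nF D.π ^ j ≤ 1 := pow_le_one₀ D.π_pos.le D.π_lt.le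

lemma T_le (j : ℕ) : ∀ a b, D.nF (D.T j a b) ≤ 1 := by
  intro a b
  fin_cases a <;> fin_cases b <;> simp [T, D.pow_le_one']

lemma le_nV_rowMul_T (v : F × F) (j : ℕ) :
    D.nF D.π ^ j * D.nV v ≤ D.nV (rowMul v (D.T j)) := by
  rw [rowMul_T]
  simp only [nV, map_mul, map_pow]
  rw [mul_max_of_nonneg _ _ (pow_nonneg D.π_pos.le j)]
  refine max_le_max ?_ (by rw [mul_comm])
  exact mul_le_of_le_one_left (D.nF.nonneg _) (D.pow_le_one' j)

/-- Cartan decomposition. -/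
lemma exists_cartan (g : Matrix (Fin 2) (Fin 2) F) (hg : g.det ≠ 0) :
    ∃ (z : F) (k k' : Matrix (Fin 2) (Fin 2) F) (j : ℕ), z ≠ 0 ∧ D.IsK k ∧ D.IsK k' ∧
      g = z • (k * D.T j * k') := by
  have key : ∀ g : Matrix (Fin 2) (Fin 2) F, g.det ≠ 0 →
      (∀ i j, D.nF (g i j) ≤ D.nF (g 0 0)) →
      ∃ (z : F) (k k' : Matrix (Fin 2) (Fin 2) F) (j : ℕ), z ≠ 0 ∧ D.IsK k ∧ D.IsK k' ∧
      g = z • (k * D.T j * k') := by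
    intro g hg hmax
    have h00 : g 0 0 ≠ 0 := by
      intro h
      apply hg
      have hz : ∀ i j, g i j = 0 := fun i j => by
        have := hmax i j
        rw [h, map_zero] at this
        exact D.nF.eq_zero.1 (this.antisymm (D.nF.nonneg _))
      rw [Matrix.det_fin_two]
      simp [hz]
    have hdiv : ∀ i j, D.nF (g i j / g 0 0) ≤ 1 := fun i j => by
      rw [map_div₀]
      exact (div_le_one (D.nF.pos h00)).2 (hmax i j)
    set e := g 1 1 / g 0 0 - g 0 1 / g 0 0 * (g 1 0 / g 0 0) with he
    have hdet : g.det = g 0 0 ^ 2 * e := by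
      rw [Matrix.det_fin_two, he]; field_simp
    have he0 : e ≠ 0 := by
      intro h
      apply hg
      rw [hdet, h, mul_zero]
    have hele : D.nF e ≤ 1 := D.nF_sub_le (hdiv _ _) (D.nF_mul_le_one (hdiv _ _) (hdiv _ _))
    obtain ⟨j, hj⟩ := D.disc e he0
    have hj0 : 0 ≤ j := by
      by_contra hneg
      rw [hj] at hele
      exact absurd hele (not_le.2 (one_lt_zpow_of_neg₀ D.π_pos D.π_lt (not_le.1 hneg)))
    lift j to ℕ using hj0
    rw [zpow_natCast] at hj
    have hπj : D.π ^ j ≠ 0 := pow_ne_zero j D.π_ne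
    have hu : D.nF (e / D.π ^ j) = 1 := by
      rw [map_div₀, map_pow, hj, div_self (pow_pos D.π_pos j).ne']
    refine ⟨g 0 0, !![1, 0; g 1 0 / g 0 0, 1], !![1, g 0 1 / g 0 0; 0, e / D.π ^ j], j, h00,
      ⟨?_, ?_⟩, ⟨?_, ?_⟩, ?_⟩
    · intro a b
      fin_cases a <;> fin_cases b <;> simp [hdiv, -map_div₀]
    · simp [Matrix.det_fin_two]
    · intro a b
      fin_cases a <;> fin_cases b <;> simp [hdiv, hu, -map_div₀]
    · rw [Matrix.det_fin_two]; simpa [-map_div₀] using hu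
    · ext a b
      fin_cases a <;> fin_cases b <;>
        simp [T, he] <;> field_simp
      ring
  obtain ⟨⟨i, j⟩, -, hij⟩ := Finset.exists_max_image (Finset.univ : Finset (Fin 2 × Fin 2))
    (fun p => D.nF (g p.1 p.2)) ⟨(0, 0), by simp⟩
  have hij' : ∀ a b, D.nF (g a b) ≤ D.nF (g i j) := fun a b => hij (a, b) (by simp)
  set w : Fin 2 → Matrix (Fin 2) (Fin 2) F := fun i => if i = 0 then 1 else !![0, 1; 1, 0] with hw
  have hwK : ∀ i, D.IsK (w i) := by
    intro i
    fin_cases i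
    · simpa [hw] using IsK.one D
    · refine ⟨fun a b => ?_, by simp [hw, Matrix.det_fin_two]⟩
      fin_cases a <;> fin_cases b <;> simp [hw]
  have hww : ∀ i, w i * w i = 1 := by
    intro i
    fin_cases i <;> simp [hw, Matrix.one_fin_two]
  have hentry : ∀ a b, (w i * g * w j) a b = g (if i = 0 then a else 1 - a)
      (if j = 0 then b else 1 - b) := by
    intro a b
    simp only [Matrix.mul_apply, Fin.sum_univ_two]
    fin_cases i <;> fin_cases j <;> fin_cases a <;> fin_cases b <;> simp [hw]
  obtain ⟨z, k, k', l, hz, hk, hk', h⟩ := key (w i * g * w j)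
    (by
      rw [Matrix.det_mul, Matrix.det_mul]
      exact mul_ne_zero (mul_ne_zero (hwK i).det_ne hg) (hwK j).det_ne)
    (by
      intro a b
      rw [hentry, hentry]
      have h0 : ∀ i : Fin 2, (if i = 0 then (0 : Fin 2) else 1 - 0) = i := by decide
      rw [h0, h0]
      exact hij' _ _)
  refine ⟨z, w i * k, k' * w j, l, hz, (hwK i).mul hk, hk'.mul (hwK j), ?_⟩
  calc g = w i * (w i * g * w j) * w j := by
        rw [← mul_assoc, ← mul_assoc, hww, one_mul, mul_assoc, hww, mul_one]
    _ = _ := by rw [h]; simp [mul_assoc]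

/-! ### Homogeneous functions -/

/-- The action of a matrix on functions on `F²`. -/
def act (g : Matrix (Fin 2) (Fin 2) F) : (F × F → E) →ₗ[E] (F × F → E) where
  toFun h v := D.η g.det * h (rowMul v g)
  map_add' h h' := by ext v; simp [mul_add]
  map_smul' c h := by ext v; simp [mul_left_comm]

lemma act_apply (g : Matrix (Fin 2) (Fin 2) F) (h : F × F → E) (v : F × F) :
    D.act g h v = D.η g.det * h (rowMul v g) := rfl

lemma act_mul (g g' : Matrix (Fin 2) (Fin 2) F) (h : F × F → E) :
    D.act (g * g') h = D.act g (D.act g' h) := by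
  ext v
  simp only [act_apply, Matrix.det_mul, map_mul, rowMul_mul, mul_assoc]

lemma act_one (h : F × F → E) : D.act 1 h = h := by
  ext v
  simp [act_apply, rowMul]

/-- The homogeneous functions of weight `χ` and level `n`. -/
def level (n : ℕ) : Submodule E (F × F → E) where
  carrier := {h | h 0 = 0 ∧ (∀ x ≠ 0, ∀ v, h (x • v) = D.χ x * h v) ∧
    ∀ v v', D.nV (v' - v) ≤ D.nF D.π ^ n * D.nV v → h v' = h v}
  zero_mem' := by simp
  add_mem' := by
    rintro a b ⟨ha, ha', ha''⟩ ⟨hb, hb', hb''⟩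
    refine ⟨by simp [ha, hb], fun x hx v => ?_, fun v v' h => ?_⟩
    · simp [ha' x hx, hb' x hx, mul_add]
    · simp [ha'' _ _ h, hb'' _ _ h]
  smul_mem' := by
    rintro c a ⟨ha, ha', ha''⟩
    refine ⟨by simp [ha], fun x hx v => ?_, fun v v' h => ?_⟩
    · simp [ha' x hx, mul_left_comm]
    · simp [ha'' _ _ h]

lemma level_mono : Monotone D.level := by
  rintro n n' hn h ⟨h0, h1, h2⟩
  refine ⟨h0, h1, fun v v' hv => h2 v v' (hv.trans ?_)⟩
  exact mul_le_mul_of_nonneg_right (pow_le_pow_of_le_one D.π_pos.le D.π_lt.le hn) (D.nV_nonneg v)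

variable {D} in
lemma smul_apply_of_level {n : ℕ} {h : F × F → E} (hh : h ∈ D.level n) (x : F) (v : F × F) :
    h (x • v) = D.χ x * h v := by
  rcases eq_or_ne x 0 with rfl | hx
  · simp [hh.1]
  · exact hh.2.1 x hx v

lemma act_mem_level_of_isK {n : ℕ} {k : Matrix (Fin 2) (Fin 2) F} (hk : D.IsK k)
    {h : F × F → E} (hh : h ∈ D.level n) : D.act k h ∈ D.level n := by
  refine ⟨by simp [act_apply, rowMul, hh.1, ← Prod.zero_eq_mk], fun x _ v => ?_,
    fun v v' hv => ?_⟩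
  · rw [act_apply, act_apply, rowMul_smul, smul_apply_of_level hh, mul_left_comm]
  · rw [act_apply, act_apply, hh.2.2 (rowMul v k) (rowMul v' k)]
    rwa [← rowMul_sub, hk.nV_rowMul, hk.nV_rowMul]

lemma act_T_mem_level {n j : ℕ} {h : F × F → E} (hh : h ∈ D.level n) :
    D.act (D.T j) h ∈ D.level (n + j) := by
  refine ⟨by simp [act_apply, rowMul, hh.1, ← Prod.zero_eq_mk], fun x _ v => ?_,
    fun v v' hv => ?_⟩
  · rw [act_apply, act_apply, rowMul_smul, smul_apply_of_level hh, mul_left_comm]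
  · rw [act_apply, act_apply, hh.2.2 (rowMul v (D.T j)) (rowMul v' (D.T j))]
    rw [← rowMul_sub]
    refine (D.nV_rowMul_le (D.T_le j) _).trans (hv.trans ?_)
    rw [pow_add, mul_assoc]
    exact mul_le_mul_of_nonneg_left (D.le_nV_rowMul_T v j) (pow_nonneg D.π_pos.le n)

/-! ### Sums over the residue field -/

/-- A sum over the residue field is invariant under affine substitutions. -/
lemma sum_affine (φ : F → E)
    (hφ : ∀ x y, D.nF x ≤ 1 → D.nF y ≤ 1 → D.nF (x - y) ≤ D.nF D.π → φ x = φ y)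
    {a b : F} (ha : D.nF a = 1) (hb : D.nF b ≤ 1) :
    ∑ s ∈ D.R, φ (b + s * a) = ∑ s ∈ D.R, φ s := by
  have hle : ∀ s ∈ D.R, D.nF (b + s * a) ≤ 1 := fun s hs =>
    D.nF_add_le hb (D.nF_mul_le_one (D.R_le s hs) ha.le)
  have hinj : Set.InjOn (fun s => D.rep (b + s * a)) D.R := by
    intro s hs s' hs' h
    apply D.R_inj s hs s' hs'
    have h1 : D.nF ((s - s') * a) ≤ D.nF D.π := by
      have : (s - s') * a = (b + s * a - D.rep (b + s * a)) -
          (b + s' * a - D.rep (b + s' * a)) := by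
        simp only at h
        rw [h]; ring
      rw [this]
      exact D.nF_sub_le (D.rep_close _ (hle s hs)) (D.rep_close _ (hle s' hs'))
    rwa [map_mul, ha, mul_one] at h1
  have himg : D.R.image (fun s => D.rep (b + s * a)) = D.R := by
    apply Finset.eq_of_subset_of_card_le
    · intro x hx
      obtain ⟨s, hs, rfl⟩ := Finset.mem_image.1 hx
      exact D.rep_mem _ (hle s hs)
    · rw [Finset.card_image_of_injOn hinj]
  conv_rhs => rw [← himg, Finset.sum_image hinj]
  refine Finset.sum_congr rfl fun s hs => ?_
  exact hφ _ _ (hle s hs) (D.R_le _ (D.rep_mem _ (hle s hs))) (D.rep_close _ (hle s hs))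

/-- The restriction of `χ` to the units, extended by zero. -/
def χU (x : F) : E := if D.nF x = 1 then D.χ x else 0

lemma χU_congr {x y : F} (hy : D.nF y ≤ 1) (h : D.nF (x - y) ≤ D.nF D.π) :
    D.χU x = D.χU y := by
  have hlt : D.nF (x - y) < 1 := h.trans_lt D.π_lt
  unfold χU
  by_cases hy1 : D.nF y = 1
  · rw [if_pos hy1, if_pos (by rw [← hy1]; exact D.nF_eq_of_sub_lt (hy1 ▸ hlt))]
    refine D.χ_eq_of_close ?_ (by rw [hy1, mul_one]; exact h)
    rintro rfl
    simp at hy1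
  · rw [if_neg hy1, if_neg]
    intro hx1
    apply hy1
    rw [← hx1]
    refine D.nF_eq_of_sub_lt ?_
    rwa [hx1, D.nF.map_sub]

/-- The indicator of `χ` being unramified. -/
def eps : E := if ∀ u, D.nF u = 1 → D.χ u = 1 then 1 else 0

lemma eps_mul_χ {u : F} (hu : D.nF u = 1) : D.eps * D.χ u = D.eps := by
  unfold eps
  split_ifs with h
  · rw [h u hu, one_mul]
  · rw [zero_mul]

lemma nE_eps_le : D.nE D.eps ≤ 1 := by
  unfold eps
  split_ifs <;> simp

lemma card_eq_one_add_sum :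
    (D.R.card : E) = 1 + ∑ s ∈ D.R, (if D.nF s = 1 then (1 : E) else 0) := by
  have h0 : D.rep 0 ∈ D.R := D.rep_mem 0 (by simp)
  have hiff : ∀ s ∈ D.R, (D.nF s = 1 ↔ s ≠ D.rep 0) := by
    intro s hs
    have hr : D.nF (D.rep 0) ≤ D.nF D.π := by
      have := D.rep_close 0 (by simp)
      rwa [zero_sub, D.nF.map_neg] at this
    constructor
    · rintro h rfl
      rw [h] at hr
      exact absurd D.π_lt (not_lt.2 hr)
    · intro h
      by_contra h1
      apply h
      apply D.R_inj s hs _ h0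
      exact D.nF_sub_le (D.le_π_of_lt_one (lt_of_le_of_ne (D.R_le s hs) h1)) hr
  rw [← Finset.add_sum_erase _ _ h0, if_neg (by rw [hiff _ h0]; simp), zero_add,
    Finset.sum_congr rfl (g := fun _ => (1 : E))
      (fun s hs => if_pos ((hiff s (Finset.mem_of_mem_erase hs)).2 (Finset.ne_of_mem_erase hs))),
    Finset.sum_const, Finset.card_erase_of_mem h0, nsmul_eq_mul, mul_one,
    Nat.cast_sub (Finset.card_pos.2 ⟨_, h0⟩)]
  simp

/-- Orthogonality: up to the unramified correction, the character sum is divisible by the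
cardinality of the residue field. -/
lemma sum_χU_add_eps : ∑ s ∈ D.R, D.χU s + D.eps = D.eps * D.R.card := by
  by_cases h : ∀ u, D.nF u = 1 → D.χ u = 1
  · have he : D.eps = 1 := if_pos h
    rw [he, one_mul, D.card_eq_one_add_sum, add_comm]
    congr 1
    refine Finset.sum_congr rfl fun s _ => ?_
    unfold χU
    split_ifs with hs
    · exact h s hs
    · rfl
  · have he : D.eps = 0 := if_neg h
    rw [he, zero_mul, add_zero]
    push Not at h
    obtain ⟨u, hu, hu1⟩ := h
    have h1 := D.sum_affine D.χU (fun _ _ _ hy => D.χU_congr hy) hu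
      (b := 0) (by simp)
    have h2 : ∑ s ∈ D.R, D.χU (0 + s * u) = D.χ u * ∑ s ∈ D.R, D.χU s := by
      rw [Finset.mul_sum]
      refine Finset.sum_congr rfl fun s _ => ?_
      unfold χU
      rw [zero_add, map_mul, hu, mul_one, map_mul]
      split_ifs
      · ring
      · simp
    rw [h2] at h1
    by_contra hne
    exact hu1 (mul_right_cancel₀ hne (by rw [h1, one_mul]))

lemma nE_card_le : D.nE (D.R.card : E) ≤ (D.nE (D.η D.π))⁻¹ :=
  (le_inv_mul_iff₀' (zero_lt_one.trans_le D.one_le)).2 D.card_le |>.trans_eq (by simp)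

lemma nE_sum_χU_add_eps_le : D.nE (∑ s ∈ D.R, D.χU s + D.eps) ≤ (D.nE (D.η D.π))⁻¹ := by
  rw [sum_χU_add_eps, map_mul]
  exact (mul_le_of_le_one_left (D.nE.nonneg _) D.nE_eps_le).trans D.nE_card_le

/-! ### The local lattice -/

/-- The ring of integers of `E`. -/
def OE : Subring E where
  carrier := {x | D.nE x ≤ 1}
  zero_mem' := by simp
  one_mem' := by simp
  add_mem' ha hb := D.nE_add_le ha hb
  neg_mem' {a} ha := by
    simpa using ha
  mul_mem' {a b} ha hb := by
    simp only [Set.mem_ofPred_eq, map_mul] at *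
    exact mul_le_one₀ ha (D.nE.nonneg _) hb

lemma smul_OE_apply (c : D.OE) (h : F × F → E) : c • h = (c : E) • h := rfl

/-- A lattice, stable under `GL₂(O_F)`, in the space of functions of level one: the values on
primitive vectors are integral, and so is a multiple of the finite intertwining operator. -/
def L₀ : Submodule D.OE (F × F → E) where
  carrier := {h | h ∈ D.level 1 ∧ (∀ v, D.nV v = 1 → D.nE (h v) ≤ 1) ∧
    ∀ k, D.IsK k →
      D.nE (∑ s ∈ D.R, h (rowMul (1, s) k) + D.eps * h (rowMul (0, 1) k)) ≤
        (D.nE (D.η D.π))⁻¹}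
  zero_mem' := by
    refine ⟨zero_mem _, by simp, fun k hk => ?_⟩
    simp [D.nE.nonneg]
  add_mem' := by
    rintro a b ⟨ha, ha', ha''⟩ ⟨hb, hb', hb''⟩
    refine ⟨add_mem ha hb, fun v hv => D.nE_add_le (ha' v hv) (hb' v hv), fun k hk => ?_⟩
    convert D.nE_add_le (ha'' k hk) (hb'' k hk) using 2
    simp only [Pi.add_apply, Finset.sum_add_distrib]
    ring
  smul_mem' := by
    rintro ⟨c, hc⟩ a ⟨ha, ha', ha''⟩
    have hc : D.nE c ≤ 1 := hc
    refine ⟨Submodule.smul_mem _ c ha, fun v hv => ?_, fun k hk => ?_⟩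
    · rw [smul_OE_apply, Pi.smul_apply, smul_eq_mul, map_mul]
      exact mul_le_one₀ hc (D.nE.nonneg _) (ha' v hv)
    · have : ∑ s ∈ D.R, c * a (rowMul (1, s) k) + D.eps * (c * a (rowMul (0, 1) k)) =
          c * (∑ s ∈ D.R, a (rowMul (1, s) k) + D.eps * a (rowMul (0, 1) k)) := by
        rw [mul_add, Finset.mul_sum]; ring
      change D.nE (∑ s ∈ D.R, c * a (rowMul (1, s) k) + D.eps * (c * a (rowMul (0, 1) k))) ≤ _
      rw [this, map_mul]
      exact (mul_le_of_le_one_left (D.nE.nonneg _) hc).trans (ha'' k hk)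

lemma act_mem_L₀ {k : Matrix (Fin 2) (Fin 2) F} (hk : D.IsK k) {h : F × F → E}
    (hh : h ∈ D.L₀) : D.act k h ∈ D.L₀ := by
  refine ⟨D.act_mem_level_of_isK hk hh.1, fun v hv => ?_, fun k' hk' => ?_⟩
  · rw [act_apply, map_mul, D.η_unit _ hk.2, one_mul]
    exact hh.2.1 _ (by rw [hk.nV_rowMul, hv])
  · simp only [act_apply, ← rowMul_mul]
    rw [← Finset.mul_sum, mul_left_comm, ← mul_add, map_mul, D.η_unit _ hk.2, one_mul]
    exact hh.2.2 _ (hk'.mul hk)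

/-- Scalar matrices preserve the local lattice. -/
lemma act_smul_mem_L₀ {z : F} (hz : z ≠ 0) {h : F × F → E} (hh : h ∈ D.L₀) :
    D.act (z • 1) h ∈ D.L₀ := by
  have hact : D.act (z • 1) h = (D.η z ^ 2 * D.χ z) • h := by
    ext v
    have : rowMul v (z • (1 : Matrix (Fin 2) (Fin 2) F)) = z • v := by
      ext <;> simp [rowMul, mul_comm]
    rw [act_apply, this, smul_apply_of_level hh.1, Matrix.det_smul]
    simp [mul_assoc]
  have hnorm : D.nE (D.η z ^ 2 * D.χ z) ≤ 1 := by
    obtain ⟨k, hk⟩ := D.disc z hz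
    have hu : D.nF (z / D.π ^ k) = 1 := by
      rw [map_div₀, map_zpow₀, hk, div_self (zpow_pos D.π_pos k).ne']
    have hz' : z = z / D.π ^ k * D.π ^ k := by
      rw [div_mul_cancel₀ _ (zpow_ne_zero k D.π_ne)]
    rw [hz']
    simp only [map_mul, map_pow, D.η_unit _ hu, D.χ_unit _ hu, one_mul, map_zpow₀]
    have hswap : (D.nE (D.η D.π) ^ k) ^ 2 = (D.nE (D.η D.π) ^ 2) ^ k := by
      rw [← zpow_natCast, ← zpow_natCast, ← _root_.zpow_mul, ← _root_.zpow_mul, mul_comm]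
    rw [hswap, ← mul_zpow, mul_comm, D.χ_π, _root_.one_zpow]
  rw [hact]
  exact D.L₀.smul_mem ⟨_, hnorm⟩ hh

/-- Reduction of a function of level one away from a point. -/
lemma apply_of_lt {h : F × F → E} (hh : h ∈ D.level 1) {c d : F} (hcd : D.nF d < D.nF c) :
    h (c, d) = D.χ c * h (1, 0) := by
  rw [← smul_apply_of_level hh]
  apply hh.2.2
  have := D.le_mul_of_lt hcd
  simpa [nV, D.nF.nonneg, hcd.le, mul_nonneg D.π_pos.le] using this

/-- An element of the local lattice that is constant on the residue disc belongs to the lattice at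
the neighbouring vertex. -/
lemma act_T_one_mem_L₀ {l : F × F → E} (hl : l ∈ D.L₀)
    (hc : ∀ c, D.nF c ≤ 1 → l (c, 1) = l (0, 1)) : D.act (D.T 1) l ∈ D.L₀ := by
  have hA : 0 < D.nE (D.η D.π) := zero_lt_one.trans_le D.one_le
  have hval : ∀ c d, D.nF c ≤ D.nF d → l (c, d) = D.χ d * l (0, 1) := by
    intro c d hcd
    rcases eq_or_ne d 0 with rfl | hd
    · have : c = 0 := D.nF.eq_zero.1 ((by simpa using hcd : D.nF c ≤ 0).antisymm (D.nF.nonneg _))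
      rw [this, ← Prod.zero_eq_mk, hl.1.1]; simp
    · rw [← hc (c / d) (by rw [map_div₀]; exact (div_le_one (D.nF.pos hd)).2 hcd),
        ← smul_apply_of_level hl.1]
      simp [mul_div_cancel₀ _ hd]
  have hx0 : D.nE (l (1, 0)) ≤ (D.nE (D.η D.π))⁻¹ := by
    have h1 := hl.2.2 !![1, 0; 0, 1] ⟨fun i j => by fin_cases i <;> fin_cases j <;> simp,
      by simp⟩
    have h2 : ∀ s ∈ D.R, l (rowMul (1, s) !![1, 0; 0, 1]) =
        (if D.nF s = 1 then 0 else l (1, 0)) + D.χU s * l (0, 1) := by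
      intro s hs
      have : rowMul (1, s) !![1, 0; 0, 1] = (1, s) := by simp [rowMul]
      rw [this]
      unfold χU
      split_ifs with h
      · rw [zero_add]
        exact hval _ _ (by simp [h])
      · rw [zero_mul, add_zero, D.apply_of_lt hl.1
          (by simpa using lt_of_le_of_ne (D.R_le s hs) h)]
        simp
    have h3 : ∑ s ∈ D.R, (if D.nF s = 1 then 0 else l (1, 0)) = l (1, 0) := by
      have : ∑ s ∈ D.R, (if D.nF s = 1 then 0 else l (1, 0)) =
          (D.R.card - ∑ s ∈ D.R, (if D.nF s = 1 then (1 : E) else 0)) * l (1, 0) := by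
        rw [sub_mul, Finset.sum_mul, ← nsmul_eq_mul, ← Finset.sum_const, ← Finset.sum_sub_distrib]
        refine Finset.sum_congr rfl fun s _ => ?_
        split_ifs <;> simp
      rw [this, D.card_eq_one_add_sum]
      ring
    rw [Finset.sum_congr rfl h2, Finset.sum_add_distrib, h3, ← Finset.sum_mul] at h1
    have h4 : rowMul (0, 1) !![1, 0; 0, 1] = ((0, 1) : F × F) := by simp [rowMul]
    rw [h4, add_assoc, ← add_mul] at h1
    have h5 : D.nE ((∑ s ∈ D.R, D.χU s + D.eps) * l (0, 1)) ≤ (D.nE (D.η D.π))⁻¹ := by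
      rw [map_mul]
      exact (mul_le_of_le_one_right (D.nE.nonneg _) (hl.2.1 _ (by simp [nV]))).trans
        D.nE_sum_χU_add_eps_le
    have h6 := D.nE_add_le h1 (by rwa [D.nE.map_neg] : D.nE (-((∑ s ∈ D.R, D.χU s + D.eps) *
      l (0, 1))) ≤ _)
    rwa [add_neg_cancel_right] at h6
  set x : E := D.η D.π * l (1, 0) with hx
  set y : E := D.η D.π * D.χ D.π * l (0, 1) with hy
  have hxle : D.nE x ≤ 1 := by
    rw [hx, map_mul]
    calc _ ≤ D.nE (D.η D.π) * (D.nE (D.η D.π))⁻¹ := mul_le_mul_of_nonneg_left hx0 hA.le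
      _ = 1 := mul_inv_cancel₀ hA.ne'
  have hAinv : (D.nE (D.η D.π))⁻¹ ≤ 1 := inv_le_one_of_one_le₀ D.one_le
  have hyle : D.nE y ≤ (D.nE (D.η D.π))⁻¹ := by
    have h1 : D.nE (D.η D.π * D.χ D.π) = (D.nE (D.η D.π))⁻¹ := by
      rw [map_mul]
      apply eq_inv_of_mul_eq_one_left
      rw [← D.χ_π]; ring
    rw [hy, map_mul, h1]
    exact mul_le_of_le_one_right (inv_nonneg.2 hA.le) (hl.2.1 _ (by simp [nV]))
  have hact : ∀ v, D.act (D.T 1) l v = D.η D.π * l (v.1, v.2 * D.π) := by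
    intro v
    rw [act_apply, det_T, rowMul_T, pow_one]
  have hbig : ∀ v : F × F, D.nF D.π * D.nF v.2 < D.nF v.1 →
      D.act (D.T 1) l v = D.χ v.1 * x := by
    intro v hv
    rw [hact, D.apply_of_lt hl.1 (by rwa [map_mul, mul_comm]), hx]
    ring
  have hsmall : ∀ v : F × F, D.nF v.1 < D.nF v.2 → D.act (D.T 1) l v = D.χ v.2 * y := by
    intro v hv
    rw [hact, hval _ _ (by rw [map_mul, mul_comm]; exact D.le_mul_of_lt hv), hy, map_mul]
    ring
  have hunit : ∀ v : F × F, D.nV v = 1 → D.nF v.1 = 1 → D.act (D.T 1) l v = D.χ v.1 * x := by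
    intro v hv hv1
    apply hbig
    rw [hv1]
    calc D.nF D.π * D.nF v.2 ≤ D.nF D.π * 1 :=
          mul_le_mul_of_nonneg_left ((le_max_right _ _).trans hv.le) D.π_pos.le
      _ < 1 := by simpa using D.π_lt
  have hnonunit : ∀ v : F × F, D.nV v = 1 → D.nF v.1 ≠ 1 → D.nF v.2 = 1 ∧ D.nF v.1 < 1 := by
    intro v hv hv1
    have h1 : D.nF v.1 < 1 := lt_of_le_of_ne ((le_max_left _ _).trans hv.le) hv1
    refine ⟨?_, h1⟩
    rcases max_choice (D.nF v.1) (D.nF v.2) with h | h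
    · exact absurd (h ▸ hv : D.nF v.1 = 1) hv1
    · exact h ▸ hv
  have hnonunit' : ∀ v : F × F, D.nV v = 1 → D.nF v.1 ≠ 1 →
      D.nE (D.act (D.T 1) l v) ≤ (D.nE (D.η D.π))⁻¹ := by
    intro v hv hv1
    obtain ⟨h2, h1⟩ := hnonunit v hv hv1
    rw [hsmall v (by rwa [h2]), map_mul, D.χ_unit _ h2, one_mul]
    exact hyle
  refine ⟨⟨?_, fun z hz v => ?_, fun v v' hv => ?_⟩, fun v hv => ?_, fun k hk => ?_⟩
  · rw [hact]
    have : ((0 : F × F).1, (0 : F × F).2 * D.π) = (0 : F × F) := by ext <;> simp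
    rw [this, hl.1.1, mul_zero]
  · exact (D.act_T_mem_level hl.1).2.1 z hz v
  · rcases eq_or_ne v 0 with rfl | hv0
    · have : v' = 0 := by
        by_contra hne
        have := D.nV_pos hne
        simp [nV] at hv
        simp [nV] at this
        rcases this with h | h
        · exact h hv.1
        · exact h hv.2
      rw [this]
    rw [pow_one] at hv
    have hvpos := D.nV_pos hv0
    have hlt : D.nF D.π * D.nV v < D.nV v := mul_lt_of_lt_one_left hvpos D.π_lt
    have hd1 : D.nF (v'.1 - v.1) ≤ D.nF D.π * D.nV v := (le_max_left _ _).trans hv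
    have hd2 : D.nF (v'.2 - v.2) ≤ D.nF D.π * D.nV v := (le_max_right _ _).trans hv
    by_cases h1 : D.nF v.1 = D.nV v
    · have hv1 : D.nF v'.1 = D.nF v.1 := D.nF_eq_of_sub_lt (by rw [h1]; exact hd1.trans_lt hlt)
      have hv2 : D.nF v.2 ≤ D.nF v.1 := h1 ▸ le_max_right _ _
      have hv2' : D.nF v'.2 ≤ D.nF v.1 := by
        have : v'.2 = v'.2 - v.2 + v.2 := by ring
        rw [this]
        exact D.nF_add_le (hd2.trans (h1 ▸ hlt.le)) hv2
      have hp : 0 < D.nF v.1 := h1 ▸ hvpos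
      rw [hbig v, hbig v', D.χ_eq_of_close (D.nF.ne_zero_iff.1 hp.ne') (by rw [h1]; exact hd1)]
      · rw [hv1]
        exact (mul_le_mul_of_nonneg_left hv2' D.π_pos.le).trans_lt
          (mul_lt_of_lt_one_left hp D.π_lt)
      · exact (mul_le_mul_of_nonneg_left hv2 D.π_pos.le).trans_lt
          (mul_lt_of_lt_one_left hp D.π_lt)
    · have h1' : D.nF v.1 < D.nV v := lt_of_le_of_ne (le_max_left _ _) h1
      have h2 : D.nF v.2 = D.nV v := by
        rcases max_choice (D.nF v.1) (D.nF v.2) with h | h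
        · exact absurd h.symm h1
        · exact h.symm
      have hv2 : D.nF v'.2 = D.nF v.2 := D.nF_eq_of_sub_lt (by rw [h2]; exact hd2.trans_lt hlt)
      have hv1 : D.nF v'.1 < D.nF v'.2 := by
        have : v'.1 = v'.1 - v.1 + v.1 := by ring
        rw [hv2, h2, this]
        exact (D.naF _ _).trans_lt (max_lt (hd1.trans_lt hlt) h1')
      rw [hsmall v (by rwa [h2]), hsmall v' hv1, D.χ_eq_of_close _ (by rw [h2]; exact hd2)]
      exact D.nF.ne_zero_iff.1 (h2 ▸ hvpos.ne')
  · by_cases h1 : D.nF v.1 = 1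
    · rw [hunit v hv h1, map_mul, D.χ_unit _ h1, one_mul]
      exact hxle
    · exact (hnonunit' v hv h1).trans hAinv
  · have hprim : ∀ s ∈ D.R, D.nV (rowMul (1, s) k) = 1 := fun s hs => by
      rw [hk.nV_rowMul]
      simpa [nV] using D.R_le s hs
    have hprim' : D.nV (rowMul (0, 1) k) = 1 := by
      rw [hk.nV_rowMul]; simp [nV]
    have hfst : ∀ s, (rowMul (1, s) k).1 = k 0 0 + s * k 1 0 := fun s => by simp [rowMul]
    have hfst' : (rowMul (0, 1) k).1 = k 1 0 := by simp [rowMul]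
    have hdecomp : ∀ v : F × F, D.nV v = 1 → ∃ r, D.nE r ≤ (D.nE (D.η D.π))⁻¹ ∧
        D.act (D.T 1) l v = D.χU v.1 * x + r := by
      intro v hv
      by_cases h1 : D.nF v.1 = 1
      · refine ⟨0, by simp, ?_⟩
        rw [hunit v hv h1, χU, if_pos h1, add_zero]
      · refine ⟨_, hnonunit' v hv h1, ?_⟩
        rw [χU, if_neg h1, zero_mul, zero_add]
    choose! r hr hr' using hdecomp
    have hmain : D.nE (∑ s ∈ D.R, D.χU (k 0 0 + s * k 1 0) + D.eps * D.χU (k 1 0)) ≤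
        (D.nE (D.η D.π))⁻¹ := by
      by_cases h1 : D.nF (k 1 0) = 1
      · rw [D.sum_affine D.χU (fun _ _ _ hy => D.χU_congr hy) h1 (hk.1 0 0)]
        have : D.eps * D.χU (k 1 0) = D.eps := by
          rw [χU, if_pos h1, D.eps_mul_χ h1]
        rw [this]
        exact D.nE_sum_χU_add_eps_le
      · have hlt : D.nF (k 1 0) < 1 := lt_of_le_of_ne (hk.1 _ _) h1
        have : ∀ s ∈ D.R, D.χU (k 0 0 + s * k 1 0) = D.χU (k 0 0) := by
          intro s hs
          have hle : D.nF (s * k 1 0) ≤ D.nF D.π :=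
            D.nF_mul_le (D.R_le s hs) (D.le_π_of_lt_one hlt)
          exact D.χU_congr (hk.1 _ _)
            (by simpa using hle)
        rw [Finset.sum_congr rfl this, Finset.sum_const, nsmul_eq_mul, χU, χU, if_neg h1, mul_zero,
          add_zero, map_mul]
        refine (mul_le_of_le_one_right (D.nE.nonneg _) ?_).trans D.nE_card_le
        split_ifs with h
        · exact (D.χ_unit _ h).le
        · simp
    have heq : ∑ s ∈ D.R, D.act (D.T 1) l (rowMul (1, s) k) +
        D.eps * D.act (D.T 1) l (rowMul (0, 1) k) =
        (∑ s ∈ D.R, D.χU (k 0 0 + s * k 1 0) + D.eps * D.χU (k 1 0)) * x +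
        (∑ s ∈ D.R, r (rowMul (1, s) k) + D.eps * r (rowMul (0, 1) k)) := by
      rw [Finset.sum_congr rfl (fun s hs => hr' _ (hprim s hs)), hr' _ hprim', hfst',
        Finset.sum_add_distrib, ← Finset.sum_mul]
      simp only [hfst]
      ring
    rw [heq]
    refine D.nE_add_le ?_ (D.nE_add_le (D.nE_sum_le _ _ (inv_nonneg.2 hA.le)
      fun s hs => hr _ (hprim s hs)) ?_)
    · rw [map_mul]
      exact (mul_le_of_le_one_right (D.nE.nonneg _) hxle).trans hmain
    · rw [map_mul]
      exact (mul_le_of_le_one_left (D.nE.nonneg _) D.nE_eps_le).trans (hr _ hprim')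

/-! ### The lattices at the vertices of the tree -/

/-- The translate of the local lattice by `k · diag(1, π ^ j)`. -/
def N (j : ℕ) (k : Matrix (Fin 2) (Fin 2) F) : Submodule D.OE (F × F → E) :=
  D.L₀.map ((D.act (k * D.T j)).restrictScalars D.OE)

lemma mem_N {j : ℕ} {k : Matrix (Fin 2) (Fin 2) F} {h : F × F → E} :
    h ∈ D.N j k ↔ ∃ l ∈ D.L₀, D.act (k * D.T j) l = h := Iff.rfl

lemma N_le_of_le {j : ℕ} {k k' : Matrix (Fin 2) (Fin 2) F} (hk : D.IsK k) (hk' : D.IsK k')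
    (h : D.nF ((k⁻¹ * k') 1 0) ≤ D.nF D.π ^ j) : D.N j k' ≤ D.N j k := by
  have hπj : D.π ^ j ≠ 0 := pow_ne_zero j D.π_ne
  set κ := k⁻¹ * k' with hκ
  have hκK : D.IsK κ := hk.inv.mul hk'
  have hk'eq : k' = k * κ := by rw [hκ, ← mul_assoc, hk.mul_inv, one_mul]
  set κ' : Matrix (Fin 2) (Fin 2) F := !![κ 0 0, κ 0 1 * D.π ^ j; κ 1 0 / D.π ^ j, κ 1 1] with hκ'
  have hdiv : D.nF (κ 1 0 / D.π ^ j) ≤ 1 := by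
    rw [map_div₀, map_pow]
    exact (div_le_one (pow_pos D.π_pos j)).2 h
  have hκ'K : D.IsK κ' := by
    refine ⟨fun a b => ?_, ?_⟩
    · have h1 : D.nF (κ 0 1 * D.π ^ j) ≤ 1 :=
        D.nF_mul_le_one (hκK.1 _ _) (by rw [map_pow]; exact D.pow_le_one' j)
      fin_cases a <;> fin_cases b
      · exact hκK.1 0 0
      · exact h1
      · exact hdiv
      · exact hκK.1 1 1
    · rw [← hκK.2, Matrix.det_fin_two, Matrix.det_fin_two κ]
      congr 1
      simp only [hκ', Matrix.of_apply, Matrix.cons_val', Matrix.cons_val_zero, Matrix.cons_val_one,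
        Matrix.cons_val_fin_one]
      field_simp
  have hcomm : κ * D.T j = D.T j * κ' := by
    ext a b
    fin_cases a <;> fin_cases b <;>
      simp [Matrix.mul_apply, Fin.sum_univ_two, T, hκ', mul_div_cancel₀ _ hπj, mul_comm]
  rintro _ ⟨l, hl, rfl⟩
  refine ⟨D.act κ' l, D.act_mem_L₀ hκ'K hl, ?_⟩
  simp only [LinearMap.coe_restrictScalars]
  rw [← act_mul, hk'eq, mul_assoc, mul_assoc, hcomm]

lemma N_eq_of_le {j : ℕ} {k k' : Matrix (Fin 2) (Fin 2) F} (hk : D.IsK k) (hk' : D.IsK k')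
    (h : D.nF ((k⁻¹ * k') 1 0) ≤ D.nF D.π ^ j) : D.N j k' = D.N j k := by
  refine le_antisymm (D.N_le_of_le hk hk' h) (D.N_le_of_le hk' hk ?_)
  have h1 : k'⁻¹ * k = (k⁻¹ * k')⁻¹ := by
    rw [Matrix.mul_inv_rev, Matrix.nonsing_inv_nonsing_inv _ (isUnit_iff_ne_zero.2 hk.det_ne)]
  have hκK : D.IsK (k⁻¹ * k') := hk.inv.mul hk'
  rw [h1, Matrix.inv_def, Ring.inverse_eq_inv', Matrix.smul_apply, smul_eq_mul, map_mul, map_inv₀,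
    hκK.2, inv_one, one_mul, Matrix.adjugate_fin_two]
  simpa using h

/-- The lattice generated by the local lattices at the vertices of the ball of radius `n`. -/
def M : ℕ → Submodule D.OE (F × F → E)
  | 0 => ⨆ k : {k // D.IsK k}, D.N 0 k
  | n + 1 => M n ⊔ ⨆ k : {k // D.IsK k}, D.N (n + 1) k

lemma N_le_M {n : ℕ} {k : Matrix (Fin 2) (Fin 2) F} (hk : D.IsK k) : D.N n k ≤ D.M n := by
  cases n with
  | zero => exact le_iSup (fun k : {k // D.IsK k} => D.N 0 k) ⟨k, hk⟩
  | succ n =>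
    exact (le_iSup (fun k : {k // D.IsK k} => D.N (n + 1) k) ⟨k, hk⟩).trans le_sup_right

lemma M_mono : Monotone D.M := monotone_nat_of_le_succ fun _ => le_sup_left

lemma M_le {n : ℕ} {P : Submodule D.OE (F × F → E)}
    (h : ∀ j ≤ n, ∀ k, D.IsK k → D.N j k ≤ P) : D.M n ≤ P := by
  induction n with
  | zero => exact iSup_le fun k => h 0 le_rfl k k.2
  | succ n ih =>
    exact sup_le (ih fun j hj => h j (hj.trans n.le_succ)) (iSup_le fun k => h _ le_rfl k k.2)

lemma M_le_level (n : ℕ) : D.M n ≤ (D.level (n + 1)).restrictScalars D.OE := by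
  refine D.M_le fun j hj k hk => ?_
  rintro _ ⟨l, hl, rfl⟩
  simp only [LinearMap.coe_restrictScalars, act_mul, Submodule.restrictScalars_mem]
  refine D.act_mem_level_of_isK hk (D.level_mono (by omega) (D.act_T_mem_level (j := j) hl.1))

lemma exists_nF_eq_nV {v : F × F} (hv : v ≠ 0) : ∃ z, z ≠ 0 ∧ D.nF z = D.nV v := by
  rcases max_choice (D.nF v.1) (D.nF v.2) with h | h
  · exact ⟨v.1, D.nF.ne_zero_iff.1 (h ▸ (D.nV_pos hv).ne'), h.symm⟩
  · exact ⟨v.2, D.nF.ne_zero_iff.1 (h ▸ (D.nV_pos hv).ne'), h.symm⟩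

lemma exists_smul_primitive {v : F × F} (hv : v ≠ 0) : ∃ z v', z ≠ 0 ∧ D.nF z = D.nV v ∧
    D.nV v' = 1 ∧ v = z • v' := by
  obtain ⟨z, hz, hzv⟩ := D.exists_nF_eq_nV hv
  refine ⟨z, z⁻¹ • v, hz, hzv, ?_, (smul_inv_smul₀ hz v).symm⟩
  rw [nV_smul, map_inv₀, hzv, inv_mul_cancel₀ (D.nV_pos hv).ne']

lemma nE_le_one_of_mem_L₀ {l : F × F → E} (hl : l ∈ D.L₀) {v : F × F} (hv : D.nV v ≤ 1) :
    D.nE (l v) ≤ 1 := by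
  rcases eq_or_ne v 0 with rfl | hv0
  · simp [hl.1.1]
  obtain ⟨z, v', -, hzv, hv', rfl⟩ := D.exists_smul_primitive hv0
  rw [smul_apply_of_level hl.1, map_mul]
  exact mul_le_one₀ (D.nE_χ_le_one (hzv ▸ hv)) (D.nE.nonneg _) (hl.2.1 v' hv')

lemma nE_le_of_mem_M {n : ℕ} {h : F × F → E} (hh : h ∈ D.M n) {v : F × F} (hv : D.nV v ≤ 1) :
    D.nE (h v) ≤ D.nE (D.η D.π) ^ n := by
  have hA : 0 ≤ D.nE (D.η D.π) ^ n := pow_nonneg (D.nE.nonneg _) n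
  let P : Submodule D.OE (F × F → E) :=
    { carrier := {h | D.nE (h v) ≤ D.nE (D.η D.π) ^ n}
      zero_mem' := by simp
      add_mem' := fun ha hb => D.nE_add_le ha hb
      smul_mem' := by
        rintro ⟨c, hc⟩ a ha
        change D.nE (c * a v) ≤ _
        rw [map_mul]
        exact (mul_le_of_le_one_left (D.nE.nonneg _) hc).trans ha }
  refine D.M_le (P := P) (fun j hj k hk => ?_) hh
  rintro _ ⟨l, hl, rfl⟩
  change D.nE (D.act (k * D.T j) l v) ≤ _
  rw [act_apply, map_mul, Matrix.det_mul, map_mul, map_mul, D.η_unit _ hk.2, one_mul, det_T,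
    map_pow, map_pow]
  refine (mul_le_of_le_one_right (pow_nonneg (D.nE.nonneg _) _)
    (D.nE_le_one_of_mem_L₀ hl ?_)).trans (pow_le_pow_right₀ D.one_le hj)
  rw [rowMul_mul]
  exact (D.nV_rowMul_le (D.T_le j) _).trans (by rwa [hk.nV_rowMul])

/-- The lattice generated on a larger ball induces the given one on a smaller ball. -/
lemma mem_M_of_mem_level {n : ℕ} {x : F × F → E} (hx : x ∈ D.M (n + 1))
    (hxl : x ∈ D.level (n + 1)) : x ∈ D.M n := by
  obtain ⟨y, hy, z, hz, rfl⟩ := Submodule.mem_sup.1 hx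
  rw [← sSup_range, sSup_eq_iSup', Submodule.mem_iSup_iff_exists_finsupp] at hz
  obtain ⟨f, hf, rfl⟩ := hz
  refine add_mem hy (sum_mem fun S _ => ?_)
  obtain ⟨S, ⟨k, hk⟩, hS⟩ := S
  simp only at hS
  obtain ⟨l, hl, hlf⟩ := D.mem_N.1 (hS ▸ hf ⟨S, ⟨k, hk⟩, hS⟩ : f ⟨S, ⟨k, hk⟩, hS⟩ ∈ D.N (n + 1) k)
  set S₀ : Set.range fun k : {k // D.IsK k} => D.N (n + 1) k := ⟨S, ⟨k, hk⟩, hS⟩ with hS₀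
  set v : F → F × F := fun c => rowMul (D.π ^ (n + 1) * c, 1) k⁻¹ with hv
  have hvk : ∀ c, rowMul (v c) k = (D.π ^ (n + 1) * c, 1) := by
    intro c
    rw [hv, ← rowMul_mul, hk.inv_mul]
    simp [rowMul]
  have hπn : 0 < D.nF D.π ^ (n + 1) := pow_pos D.π_pos _
  have hv0 : D.nV (v 0) = 1 := by
    rw [← hk.nV_rowMul, hvk]; simp [nV]
  have hclose : ∀ c, D.nF c ≤ 1 → D.nV (v c - v 0) ≤ D.nF D.π ^ (n + 1) * D.nV (v 0) := by
    intro c hc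
    rw [← hk.nV_rowMul, rowMul_sub, hvk, hvk, hv0, mul_one]
    simp only [nV, mul_zero, Prod.mk_sub_mk, sub_zero, sub_self, map_zero, map_mul, map_pow]
    exact max_le (mul_le_of_le_one_right hπn.le hc) hπn.le
  have hother : ∀ S ≠ S₀, ∀ c, D.nF c ≤ 1 → f S (v c) = f S (v 0) := by
    rintro ⟨S', ⟨k', hk'⟩, hS'⟩ hne c hc
    simp only at hS'
    obtain ⟨l', hl', hlf'⟩ := D.mem_N.1
      (hS' ▸ hf ⟨S', ⟨k', hk'⟩, hS'⟩ : f ⟨S', ⟨k', hk'⟩, hS'⟩ ∈ D.N (n + 1) k')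
    have hlt : D.nF D.π ^ (n + 1) < D.nF ((k⁻¹ * k') 1 0) := by
      by_contra hle
      apply hne
      refine Subtype.ext (hS'.symm.trans (Eq.trans ?_ hS))
      exact D.N_eq_of_le hk hk' (not_lt.1 hle)
    set κ := k⁻¹ * k' with hκ
    have hκK : D.IsK κ := hk.inv.mul hk'
    have hκ0 : κ 1 0 ≠ 0 := D.nF.ne_zero_iff.1 (hπn.trans hlt).ne'
    have hsmall : ∀ c, D.nF c ≤ 1 → D.nF (D.π ^ (n + 1) * c * κ 0 0) ≤ D.nF D.π ^ (n + 1) := by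
      intro c hc
      rw [mul_assoc]
      exact D.nF_mul_le' (by rw [map_pow]) (D.nF_mul_le_one hc (hκK.1 _ _))
    have hfst : ∀ c, D.nF c ≤ 1 → D.nF (D.π ^ (n + 1) * c * κ 0 0 + κ 1 0) = D.nF (κ 1 0) := by
      intro c hc
      apply D.nF_eq_of_sub_lt
      rw [add_sub_cancel_right]
      exact (hsmall c hc).trans_lt hlt
    have hval : ∀ c, D.nF c ≤ 1 → D.act (k' * D.T (n + 1)) l' (v c) =
        D.η (k' * D.T (n + 1)).det * (D.χ (κ 1 0) * l' (1, 0)) := by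
      intro c hc
      have hrow : rowMul (v c) k' = rowMul (D.π ^ (n + 1) * c, 1) κ := by
        rw [hκ, rowMul_mul, hv]
      have hchi : D.χ (D.π ^ (n + 1) * c * κ 0 0 + κ 1 0) = D.χ (κ 1 0) := by
        apply D.χ_eq_of_close hκ0
        rw [add_sub_cancel_right]
        exact D.le_mul_of_lt ((hsmall c hc).trans_lt hlt)
      rw [act_apply, rowMul_mul, hrow, rowMul_T, D.apply_of_lt hl'.1]
      · simp only [rowMul, one_mul, hchi]
      · simp only [rowMul, one_mul]
        rw [hfst c hc]
        refine lt_of_le_of_lt (D.nF_mul_le (D.nF_add_le ?_ (hκK.1 _ _)) ?_) hlt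
        · rw [mul_assoc]
          exact D.nF_mul_le_one (by rw [map_pow]; exact D.pow_le_one' _)
            (D.nF_mul_le_one hc (hκK.1 _ _))
        · rw [map_pow]
    rw [← hlf', hval c hc, hval 0 (by simp)]
  have hconst : ∀ c, D.nF c ≤ 1 → f S₀ (v c) = f S₀ (v 0) := by
    intro c hc
    have h1 := hxl.2.2 _ _ (hclose c hc)
    have h2 := (D.M_le_level n hy).2.2 _ _ (hclose c hc)
    have h3 : ∀ w, (f.sum fun _ z => z) w = f S₀ w + ∑ S ∈ f.support.erase S₀, f S w := by
      intro w
      rw [Finsupp.sum, Finset.sum_apply]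
      by_cases hmem : S₀ ∈ f.support
      · rw [Finset.add_sum_erase _ (fun S => f S w) hmem]
      · rw [Finset.erase_eq_of_notMem hmem, Finsupp.notMem_support_iff.1 hmem]
        simp
    rw [Pi.add_apply, Pi.add_apply, h2, add_right_inj, h3, h3,
      Finset.sum_congr rfl (fun S hS => hother S (Finset.ne_of_mem_erase hS) c hc)] at h1
    exact add_right_cancel h1
  have hl1 : ∀ c, D.nF c ≤ 1 → l (c, 1) = l (0, 1) := by
    intro c hc
    have h1 : ∀ c, f S₀ (v c) =
        D.η (k * D.T (n + 1)).det * (D.χ (D.π ^ (n + 1)) * l (c, 1)) := by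
      intro c
      rw [← hlf, act_apply, rowMul_mul, hvk, rowMul_T, ← smul_apply_of_level hl.1]
      simp
    have h2 := hconst c hc
    rw [h1, h1] at h2
    have hdet : (k * D.T (n + 1)).det ≠ 0 := by
      rw [Matrix.det_mul, det_T]
      exact mul_ne_zero hk.det_ne (pow_ne_zero _ D.π_ne)
    exact mul_left_cancel₀ ((map_ne_zero D.χ).2 (pow_ne_zero _ D.π_ne))
      (mul_left_cancel₀ ((map_ne_zero D.η).2 hdet) h2)
  apply D.N_le_M hk
  refine D.mem_N.2 ⟨_, D.act_T_one_mem_L₀ hl hl1, ?_⟩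
  rw [← act_mul, mul_assoc, ← T_add, hlf]

/-! ### The global lattice -/

/-- The lattice generated by all translates of the local lattice. -/
def L : Submodule D.OE (F × F → E) := ⨆ n, D.M n

lemma mem_L {h : F × F → E} : h ∈ D.L ↔ ∃ n, h ∈ D.M n :=
  Submodule.mem_iSup_of_directed _ D.M_mono.directed_le

lemma act_L₀_mem_L {g : Matrix (Fin 2) (Fin 2) F} (hg : g.det ≠ 0) {l : F × F → E}
    (hl : l ∈ D.L₀) : D.act g l ∈ D.L := by
  obtain ⟨z, k, k', j, hz, hk, hk', rfl⟩ := D.exists_cartan g hg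
  refine D.mem_L.2 ⟨j, D.N_le_M hk (D.mem_N.2 ⟨_, D.act_smul_mem_L₀ hz (D.act_mem_L₀ hk' hl), ?_⟩)⟩
  rw [← act_mul, ← act_mul]
  simp

lemma act_mem_L {g : Matrix (Fin 2) (Fin 2) F} (hg : g.det ≠ 0) {h : F × F → E}
    (hh : h ∈ D.L) : D.act g h ∈ D.L := by
  obtain ⟨n, hn⟩ := D.mem_L.1 hh
  refine D.M_le (P := D.L.comap ((D.act g).restrictScalars D.OE)) (fun j _ k hk => ?_) hn
  rintro _ ⟨l, hl, rfl⟩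
  simp only [LinearMap.coe_restrictScalars, Submodule.mem_comap]
  rw [← act_mul]
  refine D.act_L₀_mem_L ?_ hl
  rw [Matrix.det_mul, Matrix.det_mul, det_T]
  exact mul_ne_zero hg (mul_ne_zero hk.det_ne (pow_ne_zero _ D.π_ne))

lemma exists_level_of_mem_L {h : F × F → E} (hh : h ∈ D.L) : ∃ n, h ∈ D.level n := by
  obtain ⟨n, hn⟩ := D.mem_L.1 hh
  exact ⟨n + 1, D.M_le_level n hn⟩

lemma mem_M_of_mem_L {n : ℕ} {h : F × F → E} (hh : h ∈ D.L) (hl : h ∈ D.level (n + 1)) :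
    h ∈ D.M n := by
  obtain ⟨m, hm⟩ := D.mem_L.1 hh
  have key : ∀ d, h ∈ D.M (n + d) → h ∈ D.M n := by
    intro d
    induction d with
    | zero => exact id
    | succ d ih =>
      exact fun hd => ih (D.mem_M_of_mem_level hd (D.level_mono (by omega) hl))
  exact key m (D.M_mono (by omega) hm)

/-- The global lattice contains no line. -/
lemma eq_zero_of_forall_smul_mem_L {x : F × F → E} (hx : ∀ c : E, c • x ∈ D.L) : x = 0 := by
  obtain ⟨n, hn⟩ := D.exists_level_of_mem_L (by simpa using hx 1)
  by_contra hne
  obtain ⟨v, hv⟩ := Function.ne_iff.1 hne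
  have hv0 : v ≠ 0 := by
    rintro rfl
    exact hv hn.1
  obtain ⟨z, v', -, -, hv', rfl⟩ := D.exists_smul_primitive hv0
  rw [smul_apply_of_level hn] at hv
  have hxv : x v' ≠ 0 := right_ne_zero_of_mul hv
  obtain ⟨b, hb⟩ := D.exists_one_lt
  obtain ⟨N, hN⟩ := pow_unbounded_of_one_lt (D.nE (D.η D.π) ^ n) hb
  have h1 := D.nE_le_of_mem_M (D.mem_M_of_mem_L (hx (b ^ N / x v'))
    (Submodule.smul_mem _ _ (D.level_mono n.le_succ hn))) hv'.le
  rw [Pi.smul_apply, smul_eq_mul, div_mul_cancel₀ _ hxv, map_pow] at h1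
  exact absurd hN (not_lt.2 h1)

/-- The homogeneous function supported on the disc of centre `c` and radius `|π| ^ j`. -/
def delta (c : F) (j : ℕ) : F × F → E := fun v =>
  if D.nF (v.1 - c * v.2) ≤ D.nF D.π ^ j * D.nF v.2 then D.χ v.2 else 0

/-- The restriction of a function to the disc of centre `c` and radius `|π| ^ j`. -/
def res (c : F) (j : ℕ) (h : F × F → E) : F × F → E := fun v =>
  if D.nF (v.1 - c * v.2) ≤ D.nF D.π ^ j * D.nF v.2 then h v else 0

lemma delta_mem_level : D.delta 0 1 ∈ D.level 1 := by
  refine ⟨by simp [delta], fun x hx v => ?_, fun v v' hv => ?_⟩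
  · have : D.nF ((x • v).1 - 0 * (x • v).2) ≤ D.nF D.π ^ 1 * D.nF (x • v).2 ↔
        D.nF (v.1 - 0 * v.2) ≤ D.nF D.π ^ 1 * D.nF v.2 := by
      simp only [Prod.smul_fst, Prod.smul_snd, smul_eq_mul, zero_mul, sub_zero, map_mul]
      rw [mul_left_comm]
      exact mul_le_mul_iff_right₀ (D.nF.pos hx)
    simp only [delta, this, mul_ite, mul_zero]
    simp
  · rcases eq_or_ne v 0 with rfl | hv0
    · have : v' = 0 := by
        by_contra hne
        have h1 := D.nV_pos hne
        rw [sub_zero] at hv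
        simp only [nV, Prod.fst_zero, Prod.snd_zero, map_zero, max_self, mul_zero] at hv h1
        exact absurd h1 (not_lt.2 hv)
      rw [this]
    rw [pow_one] at hv
    have hvpos := D.nV_pos hv0
    have hlt : D.nF D.π * D.nV v < D.nV v := mul_lt_of_lt_one_left hvpos D.π_lt
    have hd1 : D.nF (v'.1 - v.1) ≤ D.nF D.π * D.nV v := (le_max_left _ _).trans hv
    have hd2 : D.nF (v'.2 - v.2) ≤ D.nF D.π * D.nV v := (le_max_right _ _).trans hv
    simp only [delta, zero_mul, sub_zero, pow_one]
    by_cases h1 : D.nF v.1 ≤ D.nF D.π * D.nF v.2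
    · have h2 : D.nV v = D.nF v.2 := max_eq_right
        (h1.trans (mul_le_of_le_one_left (D.nF.nonneg _) D.π_lt.le))
      rw [h2] at hd1 hd2 hlt hvpos
      have hv2 : D.nF v'.2 = D.nF v.2 := D.nF_eq_of_sub_lt (hd2.trans_lt hlt)
      have hv1 : D.nF v'.1 ≤ D.nF D.π * D.nF v'.2 := by
        rw [hv2]
        have := D.nF_add_le hd1 h1
        rwa [sub_add_cancel] at this
      rw [if_pos h1, if_pos hv1]
      exact D.χ_eq_of_close (D.nF.ne_zero_iff.1 hvpos.ne') hd2
    · have h2 : D.nV v = D.nF v.1 := by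
        apply max_eq_left
        by_contra hlt'
        exact h1 (D.le_mul_of_lt (not_le.1 hlt'))
      have hv2 : D.nF v.2 ≤ D.nF v.1 := h2 ▸ le_max_right _ _
      rw [h2] at hd1 hd2 hlt hvpos
      have hv1 : D.nF v'.1 = D.nF v.1 := D.nF_eq_of_sub_lt (hd1.trans_lt hlt)
      have hv2' : D.nF v'.2 ≤ D.nF v.1 := by
        have := D.nF_add_le (hd2.trans hlt.le) hv2
        rwa [sub_add_cancel] at this
      rw [if_neg h1, if_neg]
      rw [hv1, not_le]
      exact (mul_le_mul_of_nonneg_left hv2' D.π_pos.le).trans_lt hlt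

lemma delta_mem_L₀ : (D.η D.π)⁻¹ • D.delta 0 1 ∈ D.L₀ := by
  have hA : 0 < D.nE (D.η D.π) := zero_lt_one.trans_le D.one_le
  have hle : ∀ v, D.nV v = 1 →
      D.nE (((D.η D.π)⁻¹ • D.delta 0 1) v) ≤ (D.nE (D.η D.π))⁻¹ := by
    intro v hv
    rw [Pi.smul_apply, smul_eq_mul, map_mul, map_inv₀]
    refine mul_le_of_le_one_right (inv_nonneg.2 hA.le) ?_
    unfold delta
    split_ifs
    · exact D.nE_χ_le_one ((le_max_right _ _).trans hv.le)
    · simp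
  refine ⟨Submodule.smul_mem _ _ D.delta_mem_level,
    fun v hv => (hle v hv).trans (inv_le_one_of_one_le₀ D.one_le), fun k hk => ?_⟩
  refine D.nE_add_le (D.nE_sum_le _ _ (inv_nonneg.2 hA.le) fun s hs => hle _ ?_) ?_
  · rw [hk.nV_rowMul]
    simpa [nV] using D.R_le s hs
  · rw [map_mul]
    refine (mul_le_of_le_one_left (D.nE.nonneg _) D.nE_eps_le).trans (hle _ ?_)
    rw [hk.nV_rowMul]
    simp [nV]

lemma act_mem_span_L {g : Matrix (Fin 2) (Fin 2) F} (hg : g.det ≠ 0) {h : F × F → E}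
    (hh : h ∈ Submodule.span E (D.L : Set (F × F → E))) :
    D.act g h ∈ Submodule.span E (D.L : Set (F × F → E)) :=
  (Submodule.map_span_le (D.act g) _ _).2
    (fun _ hl => Submodule.subset_span (D.act_mem_L hg hl)) (Submodule.mem_map_of_mem hh)

lemma delta_mem_span (c : F) (j : ℕ) :
    D.delta c (j + 1) ∈ Submodule.span E (D.L : Set (F × F → E)) := by
  have h0 : D.delta 0 1 ∈ Submodule.span E (D.L : Set (F × F → E)) := by
    have h1 : (D.η D.π)⁻¹ • D.delta 0 1 ∈ Submodule.span E (D.L : Set (F × F → E)) := by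
      refine Submodule.subset_span ?_
      have := D.act_L₀_mem_L (g := 1) (by simp) D.delta_mem_L₀
      rwa [act_one] at this
    have h2 := Submodule.smul_mem _ (D.η D.π) h1
    rwa [smul_inv_smul₀ ((map_ne_zero D.η).2 D.π_ne)] at h2
  have hπj : D.π ^ j ≠ 0 := pow_ne_zero j D.π_ne
  have hdet : (!![1, 0; -c, D.π ^ j] : Matrix (Fin 2) (Fin 2) F).det = D.π ^ j := by
    simp [Matrix.det_fin_two]
  have h3 := Submodule.smul_mem _ (D.η (D.π ^ j) * D.χ (D.π ^ j))⁻¹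
    (D.act_mem_span_L (g := !![1, 0; -c, D.π ^ j]) (by rwa [hdet]) h0)
  convert h3 using 1
  ext v
  have hrow : rowMul v !![1, 0; -c, D.π ^ j] = (v.1 - c * v.2, v.2 * D.π ^ j) := by
    ext <;> simp [rowMul]
    ring
  rw [Pi.smul_apply, act_apply, hdet, hrow, smul_eq_mul]
  have hη := (map_ne_zero D.η).2 hπj
  have hχ := (map_ne_zero D.χ).2 hπj
  have hcond : D.nF (v.1 - c * v.2 - 0 * (v.2 * D.π ^ j)) ≤
      D.nF D.π ^ 1 * D.nF (v.2 * D.π ^ j) ↔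
      D.nF (v.1 - c * v.2) ≤ D.nF D.π ^ (j + 1) * D.nF v.2 := by
    rw [zero_mul, sub_zero, map_mul, map_pow]
    ring_nf
  simp only [delta, hcond]
  split_ifs
  · rw [map_mul D.χ]
    field_simp
  · simp

lemma res_mem_span {n : ℕ} {h : F × F → E} (hh : h ∈ D.level (n + 1)) (i : ℕ) :
    ∀ j, j + i = n + 1 → ∀ c, D.nF c ≤ 1 →
      D.res c j h ∈ Submodule.span E (D.L : Set (F × F → E)) := by
  induction i with
  | zero =>
    rintro j rfl c hc
    convert Submodule.smul_mem _ (h (c, 1)) (D.delta_mem_span c n) using 1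
    ext v
    rw [Pi.smul_apply, smul_eq_mul, res, delta]
    split_ifs with hv
    · rw [mul_comm, ← smul_apply_of_level hh]
      apply hh.2.2
      have h1 : D.nV (v.2 • (c, (1 : F))) = D.nF v.2 := by
        rw [nV_smul]; simp [nV, hc]
      rw [h1]
      refine max_le (by simpa [mul_comm] using hv) ?_
      simpa using mul_nonneg (pow_nonneg D.π_pos.le (n + 1)) (D.nF.nonneg v.2)
    · simp
  | succ i ih =>
    intro j hj c hc
    have hle : ∀ s ∈ D.R, D.nF (c + D.π ^ j * s) ≤ 1 := fun s hs =>
      D.nF_add_le hc (D.nF_mul_le_one (by rw [map_pow]; exact D.pow_le_one' j) (D.R_le s hs))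
    have key : D.res c j h = ∑ s ∈ D.R, D.res (c + D.π ^ j * s) (j + 1) h := by
      ext v
      rw [Finset.sum_apply]
      have hπj : D.π ^ j ≠ 0 := pow_ne_zero j D.π_ne
      have hpj : 0 < D.nF D.π ^ j := pow_pos D.π_pos j
      rcases eq_or_ne v.2 0 with h2 | h2
      · have : ∀ c j, D.res c j h v = 0 := by
          intro c j
          unfold res
          split_ifs with hv
          · have hv1 : v.1 = 0 := by
              rw [h2] at hv
              simp only [mul_zero, sub_zero, map_zero] at hv
              exact D.nF.eq_zero.1 (hv.antisymm (D.nF.nonneg _))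
            rw [show v = 0 from Prod.ext hv1 h2, hh.1]
          · rfl
        simp [this]
      · have hp2 : 0 < D.nF v.2 := D.nF.pos h2
        set t := (v.1 - c * v.2) / (D.π ^ j * v.2) with ht
        have htv : v.1 - c * v.2 = t * (D.π ^ j * v.2) := by
          rw [ht, div_mul_cancel₀ _ (mul_ne_zero hπj h2)]
        have hcond : D.nF (v.1 - c * v.2) ≤ D.nF D.π ^ j * D.nF v.2 ↔ D.nF t ≤ 1 := by
          rw [htv, map_mul, map_mul, map_pow, mul_le_iff_le_one_left (mul_pos hpj hp2)]
        have hcond' : ∀ s, D.nF (v.1 - (c + D.π ^ j * s) * v.2) ≤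
            D.nF D.π ^ (j + 1) * D.nF v.2 ↔ D.nF (t - s) ≤ D.nF D.π := by
          intro s
          have : v.1 - (c + D.π ^ j * s) * v.2 = (t - s) * (D.π ^ j * v.2) := by
            rw [sub_mul, ← htv]; ring
          rw [this, map_mul, map_mul, map_pow, pow_succ', mul_assoc,
            mul_le_mul_iff_left₀ (mul_pos hpj hp2)]
        simp only [res, hcond, hcond']
        by_cases ht1 : D.nF t ≤ 1
        · rw [if_pos ht1, Finset.sum_eq_single (D.rep t), if_pos (D.rep_close t ht1)]
          · intro s hs hne
            rw [if_neg]
            intro hts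
            apply hne
            apply D.R_inj s hs _ (D.rep_mem t ht1)
            have : s - D.rep t = (t - D.rep t) - (t - s) := by ring
            rw [this]
            exact D.nF_sub_le (D.rep_close t ht1) hts
          · intro hn
            exact absurd (D.rep_mem t ht1) hn
        · rw [if_neg ht1, Finset.sum_eq_zero]
          intro s hs
          rw [if_neg]
          intro hts
          apply ht1
          have := D.nF_add_le (hts.trans D.π_lt.le) (D.R_le s hs)
          rwa [sub_add_cancel] at this
    rw [key]
    exact sum_mem fun s hs => ih (j + 1) (by omega) _ (hle s hs)

/-- The global lattice spans the space of smooth homogeneous functions. -/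
lemma mem_span_L {n : ℕ} {h : F × F → E} (hh : h ∈ D.level n) :
    h ∈ Submodule.span E (D.L : Set (F × F → E)) := by
  have hh' := D.level_mono n.le_succ hh
  have hw : D.IsK !![0, 1; 1, 0] :=
    ⟨fun a b => by fin_cases a <;> fin_cases b <;> simp, by simp [Matrix.det_fin_two]⟩
  have hdet : (!![0, 1; 1, 0] : Matrix (Fin 2) (Fin 2) F).det = -1 := by
    simp [Matrix.det_fin_two]
  have hrow : ∀ v : F × F, rowMul v !![0, 1; 1, 0] = (v.2, v.1) := fun v => by simp [rowMul]
  have key : h = D.res 0 0 h +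
      D.act !![0, 1; 1, 0] (D.res 0 1 (D.act !![0, 1; 1, 0] h)) := by
    ext v
    have h1 : D.η (-1) * D.η (-1) = 1 := by rw [← map_mul]; simp
    rw [Pi.add_apply, act_apply, hrow, hdet]
    simp only [res, act_apply, hrow, hdet, zero_mul, sub_zero, pow_zero, one_mul, pow_one,
      mul_ite, mul_zero, ← mul_assoc, h1]
    by_cases hv : D.nF v.1 ≤ D.nF v.2
    · rw [if_pos hv]
      split_ifs with h2
      · have h3 : D.nF v.2 ≤ 0 := by
          by_contra hpos
          have h4 : D.nF D.π * D.nF v.2 < D.nF v.2 := mul_lt_of_lt_one_left (not_le.1 hpos) D.π_lt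
          exact absurd (h2.trans (mul_le_mul_of_nonneg_left hv D.π_pos.le)) (not_le.2 h4)
        have h5 : v = 0 := Prod.ext (D.nF.eq_zero.1 ((hv.trans h3).antisymm (D.nF.nonneg _)))
          (D.nF.eq_zero.1 (h3.antisymm (D.nF.nonneg _)))
        rw [h5, Prod.mk.eta, hh.1, add_zero]
      · rw [add_zero]
    · rw [if_neg hv, if_pos (D.le_mul_of_lt (not_le.1 hv)), zero_add]
  rw [key]
  refine add_mem (D.res_mem_span hh' (n + 1) 0 (by omega) 0 (by simp))
    (D.act_mem_span_L (by rw [hdet]; simp) ?_)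
  exact D.res_mem_span (D.act_mem_level_of_isK hw hh') n 1 (by omega) 0 (by simp)

end TameDatum

section Residue

variable {E : Type} [Field E] {abs : AbsoluteValue E ℝ}
  {na : ∀ x y : E, abs (x + y) ≤ max (abs x) (abs y)} {F : Subfield E} {π : F}

lemma mkW_eq_iff {x y : F} : mkW E abs na F x = mkW E abs na F y ↔ abs ((x - y : F) : E) ≤ 1 := by
  rw [← sub_eq_zero, ← map_sub]
  exact QuotientAddGroup.eq_zero_iff _

/-- If multiplication by a uniformizer on `F/O_F` has kernel of cardinality `q`, then the residue
field of `F` has a system of representatives of cardinality `q`. -/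
lemma exists_residue_representatives (hπ0 : π ≠ 0) (hπ1 : abs (π : E) < 1) {q : ℕ} (hq : 0 < q)
    (hcard : Nat.card {β : Wq E abs na F // pmulW E abs na F π hπ1.le β = 0} = q) :
    ∃ (R : Finset F) (rep : F → F), R.card = q ∧ (∀ s ∈ R, abs (s : E) ≤ 1) ∧
      (∀ s ∈ R, ∀ s' ∈ R, abs ((s - s' : F) : E) ≤ abs (π : E) → s = s') ∧
      (∀ x : F, abs (x : E) ≤ 1 → rep x ∈ R) ∧
      ∀ x : F, abs (x : E) ≤ 1 → abs ((x - rep x : F) : E) ≤ abs (π : E) := by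
  set K := {β : Wq E abs na F // pmulW E abs na F π hπ1.le β = 0} with hK
  have hfin : Finite K := Nat.finite_of_card_ne_zero (by omega)
  have := Fintype.ofFinite K
  have hpos : 0 < abs (π : E) := abs.pos (by simpa using hπ0)
  have hsurj : ∀ β : K, ∃ x : F, mkW E abs na F x = β := fun β =>
    QuotientAddGroup.mk'_surjective _ β.1
  choose x hx using hsurj
  have hker : ∀ y : F, pmulW E abs na F π hπ1.le (mkW E abs na F y) = 0 ↔
      abs ((π * y : F) : E) ≤ 1 := fun y =>
    show mkW E abs na F (π * y) = 0 ↔ _ by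
      rw [← map_zero (mkW E abs na F), mkW_eq_iff, sub_zero]
  have hmul : ∀ y : F, abs ((π * y : F) : E) = abs (π : E) * abs (y : E) := fun y => by
    push_cast; rw [map_mul]
  have hinj : ∀ β β' : K, abs ((π * x β - π * x β' : F) : E) ≤ abs (π : E) → β = β' := by
    intro β β' h
    rw [← mul_sub, hmul] at h
    refine Subtype.ext ?_
    rw [← hx β, ← hx β', mkW_eq_iff]
    exact le_of_mul_le_mul_left (by simpa using h) hpos
  have hmem : ∀ y : F, abs (y : E) ≤ 1 →
      pmulW E abs na F π hπ1.le (mkW E abs na F (π⁻¹ * y)) = 0 := fun y hy => by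
    rw [hker, mul_inv_cancel_left₀ hπ0]; exact hy
  refine ⟨Finset.univ.image fun β => π * x β,
    fun y => if hy : abs (y : E) ≤ 1 then π * x ⟨_, hmem y hy⟩ else 0, ?_, ?_, ?_, ?_, ?_⟩
  · rw [Finset.card_image_of_injective, Finset.card_univ, ← Nat.card_eq_fintype_card, hcard]
    intro β β' h
    exact hinj β β' (by simp only at h; simp [h])
  · intro s hs
    obtain ⟨β, -, rfl⟩ := Finset.mem_image.1 hs
    rw [← hker, hx]
    exact β.2
  · intro s hs s' hs' h
    obtain ⟨β, -, rfl⟩ := Finset.mem_image.1 hs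
    obtain ⟨β', -, rfl⟩ := Finset.mem_image.1 hs'
    rw [hinj β β' h]
  · intro y hy
    beta_reduce
    rw [dif_pos hy]
    exact Finset.mem_image_of_mem _ (Finset.mem_univ _)
  · intro y hy
    beta_reduce
    rw [dif_pos hy]
    have h := mkW_eq_iff.1 (hx ⟨_, hmem y hy⟩).symm
    have h2 : y - π * x ⟨_, hmem y hy⟩ = π * (π⁻¹ * y - x ⟨_, hmem y hy⟩) := by
      rw [mul_sub, mul_inv_cancel_left₀ hπ0]
    rw [h2, hmul]
    exact mul_le_of_le_one_right hpos.le h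

/-- A tamely ramified character takes values of absolute value one on units. -/
lemma abs_apply_unit_of_tame {R : Finset F} {rep : F → F}
    (na : ∀ x y : E, abs (x + y) ≤ max (abs x) (abs y))
    (hmem : ∀ x : F, abs (x : E) ≤ 1 → rep x ∈ R)
    (hclose : ∀ x : F, abs (x : E) ≤ 1 → abs ((x - rep x : F) : E) ≤ abs (π : E))
    {χ : Fˣ →* Eˣ} (htame : ∀ u : Fˣ, abs (((u : F) : E) - 1) ≤ abs (π : E) → χ u = 1)
    {u : Fˣ} (hu : abs ((u : F) : E) = 1) : abs (χ u : E) = 1 := by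
  have hpow : ∀ k : ℕ, abs (((u : F) ^ k : F) : E) = 1 := fun k => by
    push_cast; rw [map_pow, hu, one_pow]
  have hmaps : Set.MapsTo (fun k : ℕ => rep ((u : F) ^ k)) Set.univ (R : Set F) :=
    fun k _ => hmem _ (hpow k).le
  obtain ⟨i, -, j, -, hij, heq⟩ := Set.infinite_univ.exists_ne_map_eq_of_mapsTo hmaps
    R.finite_toSet
  wlog hlt : i < j generalizing i j
  · exact this j i hij.symm heq.symm (lt_of_le_of_ne (not_lt.1 hlt) hij.symm)
  have hdiff : abs (((u : F) ^ j - (u : F) ^ i : F) : E) ≤ abs (π : E) := by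
    have h : (((u : F) ^ j - (u : F) ^ i : F) : E) = (((u : F) ^ j - rep ((u : F) ^ j) : F) : E) +
        -(((u : F) ^ i - rep ((u : F) ^ i) : F) : E) := by
      rw [heq]; push_cast; ring
    rw [h]
    refine (na _ _).trans (max_le (hclose _ (hpow j).le) ?_)
    rw [abs.map_neg]
    exact hclose _ (hpow i).le
  have hk : abs (((u ^ (j - i) : Fˣ) : F) - 1 : E) ≤ abs (π : E) := by
    have h : (((u : F) ^ j - (u : F) ^ i : F) : E) =
        (((u : F) ^ i : F) : E) * ((((u ^ (j - i) : Fˣ) : F) : E) - 1) := by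
      push_cast
      rw [mul_sub, ← pow_add, mul_one]
      congr 2; omega
    rwa [h, map_mul, hpow, one_mul] at hdiff
  have h1 := htame _ hk
  have h2 : abs (χ u : E) ^ (j - i) = 1 := by
    rw [← map_pow, ← Units.val_pow_eq_pow_val, ← map_pow, h1]; simp
  exact (pow_eq_one_iff_of_nonneg (abs.nonneg _) (by omega)).1 h2

end Residue

section Character

variable {E : Type} [Field E] {F : Subfield E}

lemma extChar_of_ne (χ : Fˣ →* Eˣ) {x : F} (hx : x ≠ 0) :
    extChar E F χ x = χ (Units.mk0 x hx) := dif_neg hx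

/-- The extension by zero of a character, as a morphism of monoids with zero. -/
def extCharHom (χ : Fˣ →* Eˣ) : F →*₀ E where
  toFun := extChar E F χ
  map_zero' := dif_pos rfl
  map_one' := by
    rw [extChar_of_ne χ one_ne_zero, Units.mk0_one, map_one, Units.val_one]
  map_mul' x y := by
    by_cases hx : x = 0
    · simp [extChar, hx]
    by_cases hy : y = 0
    · simp [extChar, hy]
    rw [extChar_of_ne χ hx, extChar_of_ne χ hy, extChar_of_ne χ (mul_ne_zero hx hy),
      Units.mk0_mul, map_mul, Units.val_mul]

lemma extCharHom_apply (χ : Fˣ →* Eˣ) (x : F) : extCharHom χ x = extChar E F χ x := rfl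

lemma extCharHom_of_ne (χ : Fˣ →* Eˣ) {x : F} (hx : x ≠ 0) :
    extCharHom χ x = χ (Units.mk0 x hx) := extChar_of_ne χ hx

/-- The character `x ↦ x ^ m` of `F^×` with values in `E^×`. -/
def zpowChar (F : Subfield E) (m : ℤ) : Fˣ →* Eˣ := (Units.map (F.subtype : F →* E)) ^ m

lemma zpowChar_apply (m : ℤ) (u : Fˣ) : (zpowChar F m u : E) = ((u : F) : E) ^ m := by
  rw [zpowChar, MonoidHom.zpow_apply, Units.val_zpow_eq_zpow_val]; rfl

end Character

section Transport

variable {E : Type} [Field E] {F : Subfield E}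

/-- The tame datum attached to the characters `χ₁`, `χ₂` and the representation `det ^ m`. -/
lemma exists_tameDatum [CharZero E] (abs : AbsoluteValue E ℝ)
    (na : ∀ x y : E, abs (x + y) ≤ max (abs x) (abs y)) (π : F)
    (hπ0 : π ≠ 0) (hπ1 : abs (π : E) < 1)
    (hdisc : ∀ x : F, x ≠ 0 → ∃ k : ℤ, abs (x : E) = abs (π : E) ^ k)
    (q : ℕ) (hq : 0 < q)
    (hcard : Nat.card {β : Wq E abs na F // pmulW E abs na F π hπ1.le β = 0} = q)
    (χ1 χ2 : Fˣ →* Eˣ)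
    (htame1 : ∀ u : Fˣ, abs (((u : F) : E) - 1) ≤ abs (π : E) → χ1 u = 1)
    (htame2 : ∀ u : Fˣ, abs (((u : F) : E) - 1) ≤ abs (π : E) → χ2 u = 1) (m : ℤ)
    (h1 : abs ((χ1 (Units.mk0 π hπ0) : E) * (π : E) ^ m *
      ((q : E)⁻¹ * (χ2 (Units.mk0 π hπ0) : E) * (π : E) ^ m) * (q : E)) = 1)
    (h2 : abs ((χ1 (Units.mk0 π hπ0) : E) * (π : E) ^ m) ≤ abs ((q : E)⁻¹))
    (h3 : abs ((q : E)⁻¹ * (χ2 (Units.mk0 π hπ0) : E) * (π : E) ^ m) ≤ abs ((q : E)⁻¹)) :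
    ∃ D : TameDatum F E, (∀ x : F, D.nF x = abs (x : E)) ∧ D.nE = abs ∧ D.π = π ∧
      D.χ = extCharHom (χ2 / χ1) ∧ D.η = extCharHom (χ1 * zpowChar F m) := by
  obtain ⟨R, rep, hR, hle, hinj, hmem, hclose⟩ :=
    exists_residue_representatives hπ0 hπ1 hq hcard
  have hu1 : ∀ u : Fˣ, abs ((u : F) : E) = 1 → abs (χ1 u : E) = 1 := fun u hu =>
    abs_apply_unit_of_tame na hmem hclose htame1 hu
  have hu2 : ∀ u : Fˣ, abs ((u : F) : E) = 1 → abs (χ2 u : E) = 1 := fun u hu =>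
    abs_apply_unit_of_tame na hmem hclose htame2 hu
  have hπE : (π : E) ≠ 0 := by simpa using hπ0
  have hpos : 0 < abs (π : E) := abs.pos hπE
  have hne : ∀ u : F, abs (u : E) = 1 → u ≠ 0 := by
    rintro u hu rfl
    simp at hu
  have hqE : abs (q : E) ≠ 0 := abs.ne_zero (Nat.cast_ne_zero.2 hq.ne')
  have habsχ : ∀ u : Fˣ, abs ((χ2 / χ1) u : E) = abs (χ2 u : E) / abs (χ1 u : E) := fun u => by
    rw [MonoidHom.div_apply, Units.val_div_eq_div_val, map_div₀]
  have habsη : ∀ u : Fˣ, abs ((χ1 * zpowChar F m) u : E) =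
      abs (χ1 u : E) * abs ((u : F) : E) ^ m := fun u => by
    rw [MonoidHom.mul_apply, Units.val_mul, map_mul, zpowChar_apply, map_zpow₀]
  have ha0 : abs (χ1 (Units.mk0 π hπ0) : E) ≠ 0 := abs.ne_zero (Units.ne_zero _)
  have hm0 : abs (π : E) ^ m ≠ 0 := zpow_ne_zero _ hpos.ne'
  simp only [map_mul, map_inv₀, map_zpow₀] at h1 h2 h3
  set a := abs (χ1 (Units.mk0 π hπ0) : E)
  set b := abs (χ2 (Units.mk0 π hπ0) : E)
  set p := abs (π : E) ^ m
  set Q := abs (q : E)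
  have hQpos : 0 < Q := lt_of_le_of_ne (abs.nonneg _) hqE.symm
  have hab : a * p * (b * p) = 1 := by
    rw [← h1]; field_simp
  have hb : b * p ≤ 1 := by
    have h4 := mul_le_mul_of_nonneg_left h3 hQpos.le
    rwa [mul_inv_cancel₀ hqE, ← mul_assoc, ← mul_assoc, mul_inv_cancel₀ hqE, one_mul] at h4
  have hap : 0 ≤ a * p := mul_nonneg (abs.nonneg _) (zpow_nonneg hpos.le _)
  refine ⟨{
    nF := abs.comp F.subtype.injective
    nE := abs
    naF := fun x y => na x y
    naE := na
    π := π
    π_ne := hπ0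
    π_lt := hπ1
    disc := hdisc
    R := R
    R_le := hle
    R_inj := hinj
    rep := rep
    rep_mem := hmem
    rep_close := hclose
    χ := extCharHom (χ2 / χ1)
    η := extCharHom (χ1 * zpowChar F m)
    χ_unit := ?_
    η_unit := ?_
    χ_tame := ?_
    one_le := ?_
    χ_π := ?_
    card_le := ?_
    exists_one_lt := ?_ }, fun x => rfl, rfl, rfl, rfl, rfl⟩
  · intro u hu
    change abs (u : E) = 1 at hu
    rw [extCharHom_of_ne _ (hne u hu), habsχ, hu1 _ hu, hu2 _ hu, div_one]
  · intro u hu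
    change abs (u : E) = 1 at hu
    rw [extCharHom_of_ne _ (hne u hu), habsη, hu1 _ hu, Units.val_mk0, hu, _root_.one_zpow,
      one_mul]
  · intro u hu
    change abs ((u : E) - 1) ≤ abs (π : E) at hu
    have hu0 : u ≠ 0 := by
      rintro rfl
      simp only [ZeroMemClass.coe_zero, zero_sub, abs.map_neg, map_one] at hu
      exact absurd hu (not_le.2 hπ1)
    rw [extCharHom_of_ne _ hu0, MonoidHom.div_apply, htame1 _ hu, htame2 _ hu]
    simp
  · rw [extCharHom_of_ne _ hπ0, habsη]
    change 1 ≤ a * p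
    rw [← hab]
    exact mul_le_of_le_one_right hap hb
  · rw [extCharHom_of_ne _ hπ0, extCharHom_of_ne _ hπ0, habsη, habsχ]
    change b / a * (a * p) ^ 2 = 1
    rw [← hab]; field_simp
  · rw [extCharHom_of_ne _ hπ0, habsη, hR]
    change Q * (a * p) ≤ 1
    have h4 := mul_le_mul_of_nonneg_left h2 hQpos.le
    rwa [mul_inv_cancel₀ hqE] at h4
  · exact ⟨(π : E)⁻¹, by rw [map_inv₀]; exact (one_lt_inv₀ hpos).2 hπ1⟩

/-- The bottom row of a matrix. -/
def bottomRow (g : GL (Fin 2) F) : F × F :=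
  ((g : Matrix (Fin 2) (Fin 2) F) 1 0, (g : Matrix (Fin 2) (Fin 2) F) 1 1)

lemma bottomRow_mul (g k : GL (Fin 2) F) :
    bottomRow (g * k) = rowMul (bottomRow g) (k : Matrix (Fin 2) (Fin 2) F) := by
  ext <;> simp [bottomRow, rowMul, Matrix.mul_apply, Fin.sum_univ_two]

lemma bottomRow_ne_zero (g : GL (Fin 2) F) : bottomRow g ≠ 0 := by
  intro h
  have h1 := congrArg Prod.fst h
  have h2 := congrArg Prod.snd h
  simp only [bottomRow, Prod.fst_zero, Prod.snd_zero] at h1 h2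
  have h3 : (g : Matrix (Fin 2) (Fin 2) F).det = 0 := by rw [Matrix.det_fin_two, h1, h2]; simp
  exact ((Matrix.isUnit_iff_isUnit_det _).1 g.isUnit).ne_zero h3

lemma det_ne_zero_of_GL (g : GL (Fin 2) F) : (g : Matrix (Fin 2) (Fin 2) F).det ≠ 0 :=
  ((Matrix.isUnit_iff_isUnit_det _).1 g.isUnit).ne_zero

lemma exists_bottomRow_eq {w : F × F} (hw : w ≠ 0) : ∃ g : GL (Fin 2) F, bottomRow g = w := by
  by_cases h : w.2 = 0
  · have h1 : w.1 ≠ 0 := fun h1 => hw (Prod.ext h1 h)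
    refine ⟨Matrix.GeneralLinearGroup.mkOfDetNeZero !![0, 1; w.1, 0] ?_, ?_⟩
    · simpa [Matrix.det_fin_two] using h1
    · ext <;> simp [bottomRow, Matrix.GeneralLinearGroup.mkOfDetNeZero, h]
  · refine ⟨Matrix.GeneralLinearGroup.mkOfDetNeZero !![1, 0; w.1, w.2] ?_, ?_⟩
    · simpa [Matrix.det_fin_two] using h
    · ext <;> simp [bottomRow, Matrix.GeneralLinearGroup.mkOfDetNeZero]

/-- The embedding of functions on `F²` into functions on `GL₂(F)` with values in the constant
polynomials, `h` being sent to `g ↦ χ₁ (det g) h (0, 1) g`. -/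
def toInd (χ1 : Fˣ →* Eˣ) : (F × F → E) →ₗ[E] (GL (Fin 2) F → Polynomial E) where
  toFun h g := Polynomial.C (extCharHom χ1 (g : Matrix (Fin 2) (Fin 2) F).det * h (bottomRow g))
  map_add' h h' := by ext1 g; simp [mul_add]
  map_smul' c h := by ext1 g; simp [Polynomial.smul_eq_C_mul, mul_left_comm]

lemma toInd_apply (χ1 : Fˣ →* Eˣ) (h : F × F → E) (g : GL (Fin 2) F) :
    toInd χ1 h g =
      Polynomial.C (extCharHom χ1 (g : Matrix (Fin 2) (Fin 2) F).det * h (bottomRow g)) := rfl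

lemma toInd_eq_zero {χ1 : Fˣ →* Eˣ} {h : F × F → E} (h0 : h 0 = 0) (hh : toInd χ1 h = 0) :
    h = 0 := by
  ext w
  rcases eq_or_ne w 0 with rfl | hw
  · exact h0
  obtain ⟨g, rfl⟩ := exists_bottomRow_eq hw
  have h1 := congrFun hh g
  rw [toInd_apply, Pi.zero_apply, Polynomial.C_eq_zero] at h1
  exact (mul_eq_zero.1 h1).resolve_left ((map_ne_zero _).2 (det_ne_zero_of_GL g))

lemma tauPoly_zero_C (m : ℤ) (g : Matrix (Fin 2) (Fin 2) F) (x : E) :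
    tauPoly E m 0 (matE E F g) (Polynomial.C x) = Polynomial.C ((g.det : E) ^ m * x) := by
  simp [tauPoly, matE, Matrix.det_fin_two, Polynomial.smul_eq_C_mul]

lemma rhoAct_toInd {D : TameDatum F E} {χ1 : Fˣ →* Eˣ} {m : ℤ}
    (hη : D.η = extCharHom (χ1 * zpowChar F m)) (g : GL (Fin 2) F) (h : F × F → E) :
    rhoAct E F m 0 g (toInd χ1 h) = toInd χ1 (D.act (g : Matrix (Fin 2) (Fin 2) F) h) := by
  ext1 g'
  have hηg : D.η (g : Matrix (Fin 2) (Fin 2) F).det =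
      extCharHom χ1 (g : Matrix (Fin 2) (Fin 2) F).det *
        (((g : Matrix (Fin 2) (Fin 2) F).det : F) : E) ^ m := by
    rw [hη, extCharHom_of_ne _ (det_ne_zero_of_GL g), extCharHom_of_ne _ (det_ne_zero_of_GL g),
      MonoidHom.mul_apply, Units.val_mul, zpowChar_apply, Units.val_mk0]
  rw [rhoAct, toInd_apply, tauPoly_zero_C, toInd_apply, D.act_apply, hηg, bottomRow_mul,
    Units.val_mul, Matrix.det_mul, map_mul (extCharHom χ1)]
  congr 1
  ring

/-- A tamely ramified character is trivial on determinants of matrices congruent to `1`. -/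
lemma extCharHom_det_eq_one (D : TameDatum F E) {χ1 : Fˣ →* Eˣ}
    (htame : ∀ u : Fˣ, D.nF ((u : F) - 1) ≤ D.nF D.π → χ1 u = 1) {k : GL (Fin 2) F}
    (hk : ∀ i j, D.nF ((k : Matrix (Fin 2) (Fin 2) F) i j -
      (1 : Matrix (Fin 2) (Fin 2) F) i j) ≤ D.nF D.π) :
    extCharHom χ1 (k : Matrix (Fin 2) (Fin 2) F).det = 1 := by
  rw [extCharHom_of_ne _ (det_ne_zero_of_GL k), htame, Units.val_one]
  rw [Units.val_mk0, Matrix.det_fin_two]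
  have h00 := hk 0 0
  have h01 := hk 0 1
  have h10 := hk 1 0
  have h11 := hk 1 1
  simp only [Matrix.one_apply, reduceIte, zero_ne_one, one_ne_zero, sub_zero] at h00 h01 h10 h11
  set K := (k : Matrix (Fin 2) (Fin 2) F)
  have h : K 0 0 * K 1 1 - K 0 1 * K 1 0 - 1 =
      (K 0 0 - 1) * (K 1 1 - 1) + (K 0 0 - 1) + (K 1 1 - 1) - K 0 1 * K 1 0 := by ring
  rw [h]
  exact D.nF_sub_le (D.nF_add_le (D.nF_add_le (D.nF_mul_le (h00.trans D.π_lt.le) h11) h00) h11)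
    (D.nF_mul_le (h01.trans D.π_lt.le) h10)

/-- Functions of some level give rise to elements of the induced representation. -/
lemma toInd_mem_Vrho {abs : AbsoluteValue E ℝ} {D : TameDatum F E} {χ1 χ2 : Fˣ →* Eˣ}
    (hD : ∀ x : F, D.nF x = abs (x : E)) (hχ : D.χ = extCharHom (χ2 / χ1))
    (htame : ∀ u : Fˣ, D.nF ((u : F) - 1) ≤ D.nF D.π → χ1 u = 1) {n : ℕ} {h : F × F → E}
    (hh : h ∈ D.level n) : toInd χ1 h ∈ Vrho E abs F D.π χ1 χ2 0 := by
  refine Submodule.subset_span ⟨1, fun g =>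
    extCharHom χ1 (g : Matrix (Fin 2) (Fin 2) F).det * h (bottomRow g), by simp, ⟨?_, n + 1, ?_⟩,
    ?_⟩
  · intro b hb g
    have hdet : (b : Matrix (Fin 2) (Fin 2) F).det =
        (b : Matrix (Fin 2) (Fin 2) F) 0 0 * (b : Matrix (Fin 2) (Fin 2) F) 1 1 := by
      rw [Matrix.det_fin_two, hb, mul_zero, sub_zero]
    have h11 : (b : Matrix (Fin 2) (Fin 2) F) 1 1 ≠ 0 :=
      right_ne_zero_of_mul (hdet ▸ det_ne_zero_of_GL b)
    have hrow : bottomRow (b * g) = (b : Matrix (Fin 2) (Fin 2) F) 1 1 • bottomRow g := by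
      rw [bottomRow_mul]
      ext <;> simp [rowMul, bottomRow, hb]
    have hχ11 : extCharHom χ1 ((b : Matrix (Fin 2) (Fin 2) F) 1 1) *
        D.χ ((b : Matrix (Fin 2) (Fin 2) F) 1 1) =
        extCharHom χ2 ((b : Matrix (Fin 2) (Fin 2) F) 1 1) := by
      rw [hχ, extCharHom_of_ne _ h11, extCharHom_of_ne _ h11, extCharHom_of_ne _ h11,
        ← Units.val_mul, MonoidHom.div_apply, mul_div_cancel]
    simp only
    rw [hrow, D.smul_apply_of_level hh, Units.val_mul, Matrix.det_mul, map_mul, hdet, map_mul,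
      ← extCharHom_apply, ← extCharHom_apply, ← hχ11]
    ring
  · intro g k hk
    have hk' : ∀ i j, D.nF ((k : Matrix (Fin 2) (Fin 2) F) i j -
        (1 : Matrix (Fin 2) (Fin 2) F) i j) ≤ D.nF D.π ^ (n + 1) := fun i j => by
      rw [hD, hD]; exact hk i j
    simp only
    rw [Units.val_mul, Matrix.det_mul, map_mul, extCharHom_det_eq_one D htame
      (fun i j => (hk' i j).trans (pow_le_of_le_one D.π_pos.le D.π_lt.le n.succ_ne_zero)), mul_one,
      bottomRow_mul, (D.level_mono n.le_succ hh).2.2 (bottomRow g)]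
    have hsub : rowMul (bottomRow g) (k : Matrix (Fin 2) (Fin 2) F) - bottomRow g =
        rowMul (bottomRow g) ((k : Matrix (Fin 2) (Fin 2) F) - 1) := by
      ext <;> simp [rowMul] <;> ring
    rw [hsub]
    have hbd : ∀ x i j, D.nF x ≤ D.nV (bottomRow g) →
        D.nF (x * ((k : Matrix (Fin 2) (Fin 2) F) - 1) i j) ≤
          D.nF D.π ^ (n + 1) * D.nV (bottomRow g) := fun x i j hx => by
      rw [map_mul, mul_comm]
      exact mul_le_mul (hk' i j) hx (D.nF.nonneg _) (pow_nonneg D.π_pos.le _)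
    exact max_le
      (D.nF_add_le (hbd _ _ _ (le_max_left _ _)) (hbd _ _ _ (le_max_right _ _)))
      (D.nF_add_le (hbd _ _ _ (le_max_left _ _)) (hbd _ _ _ (le_max_right _ _)))
  · ext1 g
    rw [toInd_apply, Polynomial.smul_eq_C_mul, mul_one]

/-- Two vectors that are close to each other are related by a matrix congruent to `1`. -/
lemma exists_rowMul_eq (D : TameDatum F E) {N : ℕ} (hN : 1 ≤ N) {v v' : F × F} (hv : v ≠ 0)
    (h : D.nV (v' - v) ≤ D.nF D.π ^ N * D.nV v) :
    ∃ k : GL (Fin 2) F, rowMul v (k : Matrix (Fin 2) (Fin 2) F) = v' ∧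
      ∀ i j, D.nF ((k : Matrix (Fin 2) (Fin 2) F) i j -
        (1 : Matrix (Fin 2) (Fin 2) F) i j) ≤ D.nF D.π ^ N := by
  have hpN : 0 ≤ D.nF D.π ^ N := pow_nonneg D.π_pos.le _
  have hlt : D.nF D.π ^ N < 1 := pow_lt_one₀ D.π_pos.le D.π_lt (by omega)
  have hunit : ∀ x, D.nF x ≤ D.nF D.π ^ N → 1 + x ≠ 0 := fun x hx h0 => by
    rw [eq_neg_of_add_eq_zero_right h0, D.nF.map_neg, map_one] at hx
    exact absurd hx (not_le.2 hlt)
  have hdiv : ∀ x y, y ≠ 0 → D.nF y = D.nV v → D.nF x ≤ D.nF D.π ^ N * D.nV v →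
      D.nF (x / y) ≤ D.nF D.π ^ N := fun x y hy hyv hx => by
    rw [map_div₀, div_le_iff₀ (D.nF.pos hy), hyv]; exact hx
  have hx1 := (le_max_left _ _).trans h
  have hx2 := (le_max_right _ _).trans h
  rcases le_total (D.nF v.1) (D.nF v.2) with h12 | h12
  · have hy : D.nF v.2 = D.nV v := (max_eq_right h12).symm
    have hy0 : v.2 ≠ 0 := D.nF.ne_zero_iff.1 (hy ▸ (D.nV_pos hv).ne')
    have h1 := hdiv _ _ hy0 hy hx1
    have h2 := hdiv _ _ hy0 hy hx2
    refine ⟨Matrix.GeneralLinearGroup.mkOfDetNeZero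
      !![1, 0; (v' - v).1 / v.2, 1 + (v' - v).2 / v.2] ?_, ?_, ?_⟩
    · rw [Matrix.det_fin_two_of, one_mul, zero_mul, sub_zero]
      exact hunit _ h2
    · refine Prod.ext ?_ ?_ <;> simp [rowMul, Matrix.GeneralLinearGroup.mkOfDetNeZero] <;>
        field_simp <;> ring
    · intro i j
      fin_cases i <;> fin_cases j <;>
        simp [Matrix.GeneralLinearGroup.mkOfDetNeZero, hpN] <;>
        first | simpa using h1 | simpa using h2
  · have hy : D.nF v.1 = D.nV v := (max_eq_left h12).symm
    have hy0 : v.1 ≠ 0 := D.nF.ne_zero_iff.1 (hy ▸ (D.nV_pos hv).ne')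
    have h1 := hdiv _ _ hy0 hy hx1
    have h2 := hdiv _ _ hy0 hy hx2
    refine ⟨Matrix.GeneralLinearGroup.mkOfDetNeZero
      !![1 + (v' - v).1 / v.1, (v' - v).2 / v.1; 0, 1] ?_, ?_, ?_⟩
    · rw [Matrix.det_fin_two_of, mul_one, mul_zero, sub_zero]
      exact hunit _ h1
    · refine Prod.ext ?_ ?_ <;> simp [rowMul, Matrix.GeneralLinearGroup.mkOfDetNeZero] <;>
        field_simp <;> ring
    · intro i j
      fin_cases i <;> fin_cases j <;>
        simp [Matrix.GeneralLinearGroup.mkOfDetNeZero, hpN] <;>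
        first | simpa using h1 | simpa using h2

/-- Every function in the induced representation comes from a function of some level. -/
lemma exists_level_of_isIndFun {abs : AbsoluteValue E ℝ} {D : TameDatum F E} {χ1 χ2 : Fˣ →* Eˣ}
    (hD : ∀ x : F, D.nF x = abs (x : E)) (hχ : D.χ = extCharHom (χ2 / χ1))
    (htame : ∀ u : Fˣ, D.nF ((u : F) - 1) ≤ D.nF D.π → χ1 u = 1) {f : GL (Fin 2) F → E}
    (hf : IsIndFun E abs F D.π χ1 χ2 f) :
    ∃ n, ∃ h ∈ D.level n, ∀ g : GL (Fin 2) F,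
      f g = extCharHom χ1 (g : Matrix (Fin 2) (Fin 2) F).det * h (bottomRow g) := by
  obtain ⟨hB, N, hN⟩ := hf
  have hdet0 : ∀ g : GL (Fin 2) F, extCharHom χ1 (g : Matrix (Fin 2) (Fin 2) F).det ≠ 0 :=
    fun g => (map_ne_zero _).2 (det_ne_zero_of_GL g)
  have hrow : ∀ (c : F), c ≠ 0 → ∀ g g' : GL (Fin 2) F, bottomRow g = c • bottomRow g' →
      f g * (extCharHom χ1 (g : Matrix (Fin 2) (Fin 2) F).det)⁻¹ =
        D.χ c * (f g' * (extCharHom χ1 (g' : Matrix (Fin 2) (Fin 2) F).det)⁻¹) := by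
    intro c hc g g' hgg'
    obtain ⟨b, rfl⟩ : ∃ b, g = b * g' := ⟨g * g'⁻¹, by group⟩
    have hb := hgg'
    rw [bottomRow_mul] at hb
    have hbrow : bottomRow b = (0, c) := by
      have h1 := congrArg (fun v => rowMul v ((g'⁻¹ : GL (Fin 2) F) : Matrix (Fin 2) (Fin 2) F)) hb
      simp only [← rowMul_mul, rowMul_smul] at h1
      rw [← bottomRow_mul, ← Units.val_mul, mul_inv_cancel] at h1
      rw [← mul_one b, bottomRow_mul, h1]
      simp [bottomRow]
    have hb10 : (b : Matrix (Fin 2) (Fin 2) F) 1 0 = 0 := congrArg Prod.fst hbrow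
    have hb11 : (b : Matrix (Fin 2) (Fin 2) F) 1 1 = c := congrArg Prod.snd hbrow
    have hdet : (b : Matrix (Fin 2) (Fin 2) F).det =
        (b : Matrix (Fin 2) (Fin 2) F) 0 0 * c := by
      rw [Matrix.det_fin_two, hb10, hb11, mul_zero, sub_zero]
    have h00 : (b : Matrix (Fin 2) (Fin 2) F) 0 0 ≠ 0 :=
      left_ne_zero_of_mul (hdet ▸ det_ne_zero_of_GL b)
    have hχc : D.χ c = extCharHom χ2 c / extCharHom χ1 c := by
      rw [hχ, extCharHom_of_ne _ hc, extCharHom_of_ne _ hc, extCharHom_of_ne _ hc,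
        MonoidHom.div_apply, Units.val_div_eq_div_val]
    rw [hB b hb10, Units.val_mul, Matrix.det_mul, map_mul, hdet, map_mul, hb11, hχc,
      ← extCharHom_apply, ← extCharHom_apply]
    have h1 : extCharHom χ1 ((b : Matrix (Fin 2) (Fin 2) F) 0 0) ≠ 0 := (map_ne_zero _).2 h00
    have h2 : extCharHom χ1 c ≠ 0 := (map_ne_zero _).2 hc
    have h3 := hdet0 g'
    field_simp
  have hlift : ∀ w : F × F, ∃ g : GL (Fin 2) F, w ≠ 0 → bottomRow g = w := fun w => by
    by_cases hw : w = 0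
    · exact ⟨1, fun h => absurd hw h⟩
    · obtain ⟨g, hg⟩ := exists_bottomRow_eq hw
      exact ⟨g, fun _ => hg⟩
  choose s hs using hlift
  set h : F × F → E := fun w => if w = 0 then 0 else
    f (s w) * (extCharHom χ1 (s w : Matrix (Fin 2) (Fin 2) F).det)⁻¹ with h_def
  have hval : ∀ g : GL (Fin 2) F,
      h (bottomRow g) = f g * (extCharHom χ1 (g : Matrix (Fin 2) (Fin 2) F).det)⁻¹ := fun g => by
    rw [h_def]
    simp only
    rw [if_neg (bottomRow_ne_zero g), hrow 1 one_ne_zero _ g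
      (by rw [hs _ (bottomRow_ne_zero g), one_smul]), map_one, one_mul]
  refine ⟨N + 1, h, ⟨by simp [h_def], fun x hx v => ?_, fun v v' hvv' => ?_⟩, fun g => ?_⟩
  · rcases eq_or_ne v 0 with rfl | hv
    · simp [h_def]
    obtain ⟨g, rfl⟩ := exists_bottomRow_eq hv
    obtain ⟨g', hg'⟩ := exists_bottomRow_eq (smul_ne_zero hx hv)
    rw [← hg', hval, hval]
    exact hrow x hx _ _ hg'
  · rcases eq_or_ne v 0 with rfl | hv
    · have h0 : v' = 0 := by
        by_contra hne
        have h1 := D.nV_pos hne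
        simp only [sub_zero] at hvv'
        have h2 : D.nV (0 : F × F) = 0 := by simp [TameDatum.nV]
        rw [h2, mul_zero] at hvv'
        exact absurd h1 (not_lt.2 hvv')
      rw [h0]
    obtain ⟨g, rfl⟩ := exists_bottomRow_eq hv
    obtain ⟨k, rfl, hk⟩ := exists_rowMul_eq D (by omega) hv hvv'
    rw [← bottomRow_mul, hval, hval, Units.val_mul, Matrix.det_mul, map_mul,
      extCharHom_det_eq_one D htame (fun i j => (hk i j).trans
        (pow_le_of_le_one D.π_pos.le D.π_lt.le N.succ_ne_zero)), mul_one, hN]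
    intro i j
    rw [← hD D.π]
    refine le_trans ?_ (pow_le_pow_of_le_one D.π_pos.le D.π_lt.le N.le_succ)
    have h1 := hk i j
    rwa [hD] at h1
  · rw [hval]
    have h1 := hdet0 g
    field_simp

/-- The image of the lattice `D.L` is an integral structure. -/
lemma exists_integral_structure {abs : AbsoluteValue E ℝ} {D : TameDatum F E}
    {χ1 χ2 : Fˣ →* Eˣ} {m : ℤ} (hD : ∀ x : F, D.nF x = abs (x : E)) (hE : D.nE = abs)
    (hχ : D.χ = extCharHom (χ2 / χ1)) (hη : D.η = extCharHom (χ1 * zpowChar F m))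
    (htame : ∀ u : Fˣ, D.nF ((u : F) - 1) ≤ D.nF D.π → χ1 u = 1) :
    ∃ V0 : Set (GL (Fin 2) F → Polynomial E),
      V0 ⊆ (Vrho E abs F D.π χ1 χ2 0 : Set (GL (Fin 2) F → Polynomial E)) ∧
      (0 : GL (Fin 2) F → Polynomial E) ∈ V0 ∧
      (∀ x ∈ V0, ∀ y ∈ V0, x + y ∈ V0) ∧
      (∀ x ∈ V0, -x ∈ V0) ∧
      (∀ c : E, abs c ≤ 1 → ∀ x ∈ V0, c • x ∈ V0) ∧
      (∀ g : GL (Fin 2) F, ∀ x ∈ V0, rhoAct E F m 0 g x ∈ V0) ∧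
      Submodule.span E V0 = Vrho E abs F D.π χ1 χ2 0 ∧
      (∀ x : GL (Fin 2) F → Polynomial E, x ≠ 0 → ¬ (∀ c : E, c • x ∈ V0)) := by
  have hsub : toInd χ1 '' (D.L : Set (F × F → E)) ⊆ Vrho E abs F D.π χ1 χ2 0 := by
    rintro _ ⟨h, hh, rfl⟩
    obtain ⟨n, hn⟩ := D.exists_level_of_mem_L hh
    exact toInd_mem_Vrho hD hχ htame hn
  refine ⟨toInd χ1 '' (D.L : Set (F × F → E)), hsub, ⟨0, zero_mem _, map_zero _⟩, ?_, ?_, ?_, ?_,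
    ?_, ?_⟩
  · rintro _ ⟨h, hh, rfl⟩ _ ⟨h', hh', rfl⟩
    exact ⟨h + h', add_mem hh hh', map_add _ _ _⟩
  · rintro _ ⟨h, hh, rfl⟩
    exact ⟨-h, neg_mem hh, map_neg _ _⟩
  · rintro c hc _ ⟨h, hh, rfl⟩
    have hc' : c ∈ D.OE := by rw [← hE] at hc; exact hc
    exact ⟨c • h, D.L.smul_mem ⟨c, hc'⟩ hh, map_smul _ _ _⟩
  · rintro g _ ⟨h, hh, rfl⟩
    exact ⟨_, D.act_mem_L (det_ne_zero_of_GL g) hh, (rhoAct_toInd hη g h).symm⟩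
  · refine le_antisymm (Submodule.span_le.2 hsub) (Submodule.span_le.2 ?_)
    rintro _ ⟨v, f, hv, hf, rfl⟩
    obtain ⟨n, h, hh, hfh⟩ := exists_level_of_isIndFun hD hχ htame hf
    rw [← Submodule.map_span]
    rw [Polynomial.eq_C_of_degree_le_zero (p := v) (by simpa using hv)]
    refine ⟨v.coeff 0 • h, Submodule.smul_mem _ _ (D.mem_span_L hh), ?_⟩
    ext1 g
    rw [map_smul, Pi.smul_apply, toInd_apply, ← hfh, Polynomial.smul_C, Polynomial.smul_C,
      smul_eq_mul, smul_eq_mul, mul_comm]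
  · intro x hx hall
    obtain ⟨h, hh, hhx⟩ := hall 1
    rw [one_smul] at hhx
    subst hhx
    obtain ⟨n, hn⟩ := D.exists_level_of_mem_L hh
    refine hx ?_
    rw [D.eq_zero_of_forall_smul_mem_L (x := h) fun c => ?_, map_zero]
    obtain ⟨h', hh', hc⟩ := hall c
    obtain ⟨n', hn'⟩ := D.exists_level_of_mem_L hh'
    have h0 : h' - c • h = 0 := toInd_eq_zero (χ1 := χ1)
      (by simp [hn.1, hn'.1]) (by rw [map_sub, hc, map_smul, sub_self])
    rw [← sub_eq_zero.1 h0]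
    exact hh'

end Transport

/-- Theorem 1.1, case (2), of the paper: for tamely ramified smooth characters
`χ₁, χ₂` with `σ = Ind_B^G(χ₁,χ₂)` irreducible, `τ = det(·)^m` (i.e. `n = 0`), and the
Breuil–Schneider conditions satisfied, `ρ = τ ⊗ σ` admits an integral structure. -/
theorem stmt1 [CharZero E] [IsAlgClosed E]
    (abs : AbsoluteValue E ℝ)
    (na : ∀ x y : E, abs (x + y) ≤ max (abs x) (abs y))
    (F : Subfield E) (π : F)
    (hπ0 : π ≠ 0) (hπ1 : abs (π : E) < 1)
    (hdisc : ∀ x : F, x ≠ 0 → ∃ k : ℤ, abs (x : E) = abs (π : E) ^ k)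
    -- the residue field of `F` has `q` elements
    (q : ℕ) (hq : 0 < q)
    (hcard : ∀ γ : Wq E abs na F,
      Nat.card {β : Wq E abs na F // pmulW E abs na F π hπ1.le β = γ} = q)
    (χ1 χ2 : Fˣ →* Eˣ)
    -- `χ₁` and `χ₂` are tamely ramified (trivial on `1 + πO_F`; in particular smooth):
    (htame1 : ∀ u : Fˣ, abs (((u : F) : E) - 1) ≤ abs (π : E) → χ1 u = 1)
    (htame2 : ∀ u : Fˣ, abs (((u : F) : E) - 1) ≤ abs (π : E) → χ2 u = 1)
    (m : ℤ) (n : ℕ) (hn : n = 0)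
    (lam mu lamT muT : E)
    (hlam : lam = (χ1 (Units.mk0 π hπ0) : E))
    (hmu : mu = (q : E)⁻¹ * (χ2 (Units.mk0 π hπ0) : E))
    (hlamt : lamT = lam * (π : E) ^ m)
    (hmut : muT = mu * (π : E) ^ m)
    -- `σ` is irreducible, i.e. `χ₁/(ωχ₂) ≠ ω^{±1}` : since `ω` is unramified and every
    -- element of `F^×` is a unit times a power of `π`, `χ₁/(ωχ₂) = ω^{∓1}` means that
    -- `χ₁, χ₂` agree on units and `χ₁(π) = χ₂(π)` resp. `χ₁(π) = q^{-2}χ₂(π)`: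
    (hirr1 : χ1 ≠ χ2)
    (hirr2 : ¬ ((∀ u : Fˣ, abs ((u : F) : E) = 1 → χ1 u = χ2 u) ∧
      ((q : E) ^ 2 * (χ1 (Units.mk0 π hπ0) : E) = (χ2 (Units.mk0 π hπ0) : E))))
    -- the Breuil–Schneider conditions (with `n = 0`):
    (hBS1 : abs (lamT * muT * (q : E)) = 1)
    (hBS2 : abs lamT ≤ abs ((q : E)⁻¹))
    (hBS3 : abs muT ≤ abs ((q : E)⁻¹)) :
    ∃ V0 : Set (GL (Fin 2) F → Polynomial E),
      -- `V⁰` is contained in `V_ρ`: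
      V0 ⊆ (Vrho E abs F π χ1 χ2 n : Set (GL (Fin 2) F → Polynomial E)) ∧
      -- `V⁰` is an `O_E`-submodule:
      (0 : GL (Fin 2) F → Polynomial E) ∈ V0 ∧
      (∀ x ∈ V0, ∀ y ∈ V0, x + y ∈ V0) ∧
      (∀ x ∈ V0, -x ∈ V0) ∧
      (∀ c : E, abs c ≤ 1 → ∀ x ∈ V0, c • x ∈ V0) ∧
      -- `V⁰` is stable under `G`:
      (∀ g : GL (Fin 2) F, ∀ x ∈ V0, rhoAct E F m n g x ∈ V0) ∧
      -- `V⁰` spans `V_ρ` over `E`: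
      Submodule.span E V0 = Vrho E abs F π χ1 χ2 n ∧
      -- `V⁰` contains no `E`-line:
      (∀ x : GL (Fin 2) F → Polynomial E, x ≠ 0 → ¬ (∀ c : E, c • x ∈ V0)) := by
  subst hn hlamt hmut hlam hmu
  obtain ⟨D, hD, hE, rfl, hχ, hη⟩ := exists_tameDatum abs na π hπ0 hπ1 hdisc q hq (hcard 0) χ1 χ2
    htame1 htame2 m hBS1 hBS2 hBS3
  refine exists_integral_structure hD hE hχ hη fun u hu => htame1 u ?_
  rw [hD, hD] at hu
  exact hu

end BS
end
end

section
/- Let M₀(β) ⊂ V_τ, for β ∈ W, be O_E-lattices, and let M = Σ_{β∈W₁} M₀(β). Let C ∈ V_τ with C ∉ M. Then the function C·φ₀ (equal to the constant C on U_F and 0 elsewhere on F∖{0}) admits no expansion C·φ₀(x) = Σ_{l=l₀}^{∞} Σ_{β∈W} C_l(β) ψ_β(π^{-l}x) φ_l(x) with C_l(β) ∈ V_τ, finitely many nonzero for each l, and C₀(β) ∈ M₀(β) for every β. Consequently, any subset V⁰ of the space of V_τ-valued functions on F∖{0}, all of whose elements vanishing outside O_F admit such an expansion, omits the function C·φ₀.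 -/
open scoped Classical

noncomputable section

namespace BS

variable (E : Type) [Field E]

/-- `L` is an `O_E`-lattice in the `E`-vector space `V`: the `O_E`-span of a finite
spanning set (equivalently, a finitely generated `O_E`-submodule spanning `V` over `E`). -/
def IsLatticeTop (abs : AbsoluteValue E ℝ) (V : Type) [AddCommGroup V] [Module E V]
    (L : Set V) : Prop :=
  ∃ s : Finset V, Submodule.span E (s : Set V) = ⊤ ∧
    L = {v | ∃ c : V → E, (∀ x, abs (c x) ≤ 1) ∧ v = ∑ x ∈ s, c x • x}

/-- `C : ℤ → W → V_τ` is (the family of coefficients of) an expansion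
`φ(x) = Σ_{l=l₀}^∞ Σ_{β∈W} C_l(β) ψ_β(π^{-l}x) φ_l(x)`, where `φ_l` is the characteristic
function of the annulus `π^l U_F` and, on this annulus, `ψ_β(π^{-l}x) = ψ(π^{-l}bx)` for
any lift `b` of `β` (the lift `Quotient.out β` is used; on `π^l U_F` the value does not
depend on this choice). -/
def IsExpansionOf (abs : AbsoluteValue E ℝ)
    (na : ∀ x y : E, abs (x + y) ≤ max (abs x) (abs y))
    (F : Subfield E) (π : F) (ψ : F → E)
    (V : Type) [AddCommGroup V] [Module E V]
    (C : ℤ → Wq E abs na F → V) (φ : F → V) : Prop :=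
  -- `C_l = 0` for `l` below some `l₀`:
  (∃ l0 : ℤ, ∀ l : ℤ, l < l0 → ∀ β : Wq E abs na F, C l β = 0) ∧
  -- for every `l`, only finitely many `C_l(β)` are nonzero:
  (∀ l : ℤ, {β : Wq E abs na F | C l β ≠ 0}.Finite) ∧
  -- on each annulus `π^l U_F` the expansion computes `φ`:
  (∀ (l : ℤ) (x : F), abs (x : E) = abs (π : E) ^ l →
    φ x = ∑ᶠ β : Wq E abs na F, ψ (π ^ (-l) * Quotient.out β * x) • C l β)

/-- If a linear combination of distinct characters vanishes wherever the character `χ γ` is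
nontrivial, then its coefficients are invariant under translation by `γ`. -/
theorem coeff_add_eq_of_sum_eq_zero {G W K : Type*} [Monoid G] [AddCommGroup W] [Field K]
    (χ : W → G →* K) (hχ : Function.Injective χ)
    (hadd : ∀ β γ x, χ (β + γ) x = χ β x * χ γ x) (γ : W) (a : W →₀ K)
    (h : ∀ x, χ γ x ≠ 1 → (a.sum fun β c => c * χ β x) = 0) (β : W) :
    a (β + γ) = a β := by
  have hli : LinearIndependent K (fun β => (χ β : G → K)) :=
    (linearIndependent_monoidHom G K).comp χ hχ
  have key : Finsupp.mapDomain (· + γ) a = a := by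
    apply hli
    ext x
    have h1 : ∀ b : W →₀ K, Finsupp.linearCombination K (fun β => (χ β : G → K)) b x
        = b.sum fun β c => c * χ β x := by
      intro b
      simp [Finsupp.linearCombination_apply, Finsupp.sum, Finset.sum_apply]
    have h2 : ((Finsupp.mapDomain (· + γ) a).sum fun β c => c * χ β x)
        = (a.sum fun β c => c * χ β x) * χ γ x := by
      rw [Finsupp.sum_mapDomain_index (by simp) (by intros; ring), Finsupp.sum_mul]
      refine Finsupp.sum_congr fun β _ => ?_
      rw [hadd, mul_assoc]
    rw [h1, h1, h2]
    by_cases hx : χ γ x = 1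
    · rw [hx, mul_one]
    · rw [h x hx, zero_mul]
  conv_lhs => rw [← key]
  exact Finsupp.mapDomain_apply (add_left_injective γ) a β

/-- Vector-valued version: if `∑ χ β x • c β` takes the constant value `v` wherever the
nontrivial character `χ γ` is nontrivial, then `v = c 0 - c γ`. -/
theorem eq_sub_of_sum_eq_const {G W K V : Type*} [Group G] [AddCommGroup W] [Field K]
    [AddCommGroup V] [Module K V] (χ : W → G →* K) (hχ : Function.Injective χ)
    (hadd : ∀ β γ x, χ (β + γ) x = χ β x * χ γ x) {γ : W} (hγ : γ ≠ 0)
    (c : W → V) (hc : {β | c β ≠ 0}.Finite) (v : V)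
    (h : ∀ x, χ γ x ≠ 1 → v = ∑ᶠ β, χ β x • c β) : v = c 0 - c γ := by
  have h0 : ∀ x, χ 0 x = 1 := by
    intro x
    have hx : χ 0 x ≠ 0 := ((Group.isUnit x).map (χ 0)).ne_zero
    have hsq := hadd 0 0 x
    rw [add_zero] at hsq
    exact mul_left_cancel₀ hx (by rw [← hsq, mul_one])
  rw [← sub_eq_zero, ← Module.forall_dual_apply_eq_zero_iff K]
  intro d
  let a : W →₀ K := Finsupp.onFinset hc.toFinset (fun β => d (c β)) (by
    intro β hβ
    simp only [Set.Finite.mem_toFinset, Set.mem_ofPred_eq]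
    rintro h'
    simp [h'] at hβ)
  have := coeff_add_eq_of_sum_eq_zero χ hχ hadd γ (a - Finsupp.single 0 (d v)) (by
    intro x hx
    rw [Finsupp.sum_sub_index (by intros; ring), Finsupp.sum_single_index (by simp), h0,
      mul_one, h x hx]
    rw [Finsupp.onFinset_sum _ (by simp),
      finsum_eq_sum_of_support_subset (s := hc.toFinset) _ (by
        intro β hβ
        simp only [Set.Finite.coe_toFinset, Set.mem_ofPred_eq]
        rintro h'
        simp [h'] at hβ), map_sum, sub_eq_zero]
    refine Finset.sum_congr rfl fun β _ => ?_
    rw [map_smul, smul_eq_mul, mul_comm]) 0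
  simp only [zero_add, Finsupp.sub_apply, Finsupp.single_eq_same,
    Finsupp.single_eq_of_ne hγ, sub_zero] at this
  simp only [a, Finsupp.onFinset_apply] at this
  simp only [map_sub, this]
  ring

theorem IsLatticeTop.neg_mem {E : Type} [Field E] {abs : AbsoluteValue E ℝ} {V : Type}
    [AddCommGroup V] [Module E V] {L : Set V} (hL : IsLatticeTop E abs V L) {v : V}
    (hv : v ∈ L) : -v ∈ L := by
  obtain ⟨s, -, rfl⟩ := hL
  obtain ⟨c, hc, rfl⟩ := hv
  exact ⟨fun x => -c x, fun x => by rw [abs.map_neg]; exact hc x, by simp⟩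

/-- The character `x ↦ ψ (b x)` of `O_F`. -/
def charOF (abs : AbsoluteValue E ℝ)
    (na : ∀ x y : E, abs (x + y) ≤ max (abs x) (abs y))
    (F : Subfield E) (ψ : F → E) (hψadd : ∀ x y : F, ψ (x + y) = ψ x * ψ y)
    (hψ0 : ψ 0 = 1) (b : F) : Multiplicative (OFadd E abs na F) →* E where
  toFun x := ψ (b * (x.toAdd : F))
  map_one' := by simp [hψ0]
  map_mul' x y := by simp [mul_add, hψadd]

/-- Proposition 1.3 of the paper: given `O_E`-lattices `M₀(β) ⊆ V_τ` and
`C ∈ V_τ` outside `M = Σ_{β∈W₁} M₀(β)` (here `W₁ = ker(π· : W → W)`), the function `C·φ₀`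
(equal to `C` on `U_F` and `0` elsewhere) admits no expansion with `C₀(β) ∈ M₀(β)` for all
`β`; consequently any set `V⁰` of functions all of whose members vanishing outside `O_F`
admit such expansions omits `C·φ₀`. -/
theorem stmt3 [CharZero E]
    (abs : AbsoluteValue E ℝ)
    (na : ∀ x y : E, abs (x + y) ≤ max (abs x) (abs y))
    (F : Subfield E) (π : F)
    (hπ0 : π ≠ 0) (hπ1 : abs (π : E) < 1)
    (hdisc : ∀ x : F, x ≠ 0 → ∃ k : ℤ, abs (x : E) = abs (π : E) ^ k)
    -- the residue field has `q` elements
    (q : ℕ) (hq : 0 < q)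
    (hcard : ∀ γ : Wq E abs na F,
      Nat.card {β : Wq E abs na F // pmulW E abs na F π hπ1.le β = γ} = q)
    -- `ψ` is an additive character of `F`, trivial on `O_F`, under which `O_F` is its own
    -- annihilator:
    (ψ : F → E)
    (hψadd : ∀ x y : F, ψ (x + y) = ψ x * ψ y)
    (hψO : ∀ x : F, abs (x : E) ≤ 1 → ψ x = 1)
    (hψann : ∀ b : F, 1 < abs (b : E) → ∃ x : F, abs (x : E) ≤ 1 ∧ ψ (b * x) ≠ 1)
    (Vτ : Type) [AddCommGroup Vτ] [Module E Vτ] [FiniteDimensional E Vτ]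
    (M0 : Wq E abs na F → Set Vτ)
    (hM0 : ∀ β : Wq E abs na F, IsLatticeTop E abs Vτ (M0 β))
    (Cv : Vτ)
    -- `C ∉ M = Σ_{β ∈ W₁} M₀(β)`:
    (hCv : ¬ ∃ (s : Finset (Wq E abs na F)) (g : Wq E abs na F → Vτ),
      (∀ β ∈ s, pmulW E abs na F π hπ1.le β = 0) ∧ (∀ β ∈ s, g β ∈ M0 β) ∧
        Cv = ∑ β ∈ s, g β) :
    -- `C·φ₀` admits no expansion with `C₀(β) ∈ M₀(β)` for every `β`:
    (¬ ∃ C : ℤ → Wq E abs na F → Vτ,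
      IsExpansionOf E abs na F π ψ Vτ C (fun x : F => if abs (x : E) = 1 then Cv else 0) ∧
      ∀ β : Wq E abs na F, C 0 β ∈ M0 β) ∧
    -- consequently, `C·φ₀` lies outside any `V⁰` whose elements vanishing outside `O_F`
    -- all admit such expansions:
    (∀ V0 : Set (F → Vτ),
      (∀ φ ∈ V0, (∀ x : F, 1 < abs (x : E) → φ x = 0) →
        ∃ C : ℤ → Wq E abs na F → Vτ, IsExpansionOf E abs na F π ψ Vτ C φ ∧
          ∀ β : Wq E abs na F, C 0 β ∈ M0 β) →
      (fun x : F => if abs (x : E) = 1 then Cv else 0) ∉ V0) := by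
  have hψ0 : ψ 0 = 1 := hψO 0 (by simp)
  have hψne : ∀ x, ψ x ≠ 0 := by
    intro x hx
    have := hψadd x (-x)
    simp [hψ0, hx] at this
  have hmul1 : ∀ b x : F, abs (b : E) ≤ 1 → abs (x : E) ≤ 1 → ψ (b * x) = 1 := by
    intro b x hb hx
    apply hψO
    push_cast
    rw [abs.map_mul]
    exact mul_le_one₀ hb (abs.nonneg _) hx
  have hcongr : ∀ b c : F, (b : Wq E abs na F) = c → ∀ x : F, abs (x : E) ≤ 1 →
      ψ (b * x) = ψ (c * x) := by
    intro b c hbc x hx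
    have h1 : -b + c ∈ OFadd E abs na F := QuotientAddGroup.eq.mp hbc
    have h2 : c * x = b * x + (-b + c) * x := by ring
    rw [h2, hψadd, hmul1 _ _ h1 hx, mul_one]
  have hout : ∀ β : Wq E abs na F, ((Quotient.out β : F) : Wq E abs na F) = β :=
    fun β => Quotient.out_eq β
  have hπne : (π : E) ≠ 0 := by simpa using hπ0
  have hπpos : 0 < abs (π : E) := abs.pos hπne
  let χ : Wq E abs na F → Multiplicative (OFadd E abs na F) →* E :=
    fun β => charOF E abs na F ψ hψadd hψ0 (Quotient.out β)
  have hχ : ∀ β (x : Multiplicative (OFadd E abs na F)),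
      χ β x = ψ (Quotient.out β * (x.toAdd : F)) := fun _ _ => rfl
  have hinj : Function.Injective χ := by
    intro β γ hβγ
    rw [← hout β, ← hout γ]
    refine QuotientAddGroup.eq.mpr ?_
    by_contra hlt
    obtain ⟨x, hx, hne⟩ := hψann _ (not_le.mp hlt)
    apply hne
    have h1 := DFunLike.congr_fun hβγ (Multiplicative.ofAdd (⟨x, hx⟩ : OFadd E abs na F))
    rw [hχ, hχ] at h1
    have h2 := hψadd (Quotient.out β * x) ((-Quotient.out β + Quotient.out γ) * x)
    rw [← add_mul, add_neg_cancel_left] at h2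
    exact mul_left_cancel₀ (hψne (Quotient.out β * x)) (by rw [← h2, mul_one]; exact h1.symm)
  have hadd : ∀ β γ x, χ (β + γ) x = χ β x * χ γ x := by
    intro β γ x
    rw [hχ, hχ, hχ, ← hψadd, ← add_mul]
    exact hcongr _ _ (by rw [hout, QuotientAddGroup.mk_add, hout, hout]) _ x.toAdd.2
  let γ : Wq E abs na F := ((π⁻¹ : F) : Wq E abs na F)
  have hγ0 : γ ≠ 0 := by
    intro h
    have h1 : abs ((π⁻¹ : F) : E) ≤ 1 := (QuotientAddGroup.eq_zero_iff _).mp h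
    push_cast at h1
    rw [map_inv₀] at h1
    exact absurd h1 (not_le.mpr ((one_lt_inv₀ hπpos).mpr hπ1))
  have hγ1 : pmulW E abs na F π hπ1.le γ = 0 := by
    refine (QuotientAddGroup.eq_zero_iff _).mpr ?_
    change abs ((π * π⁻¹ : F) : E) ≤ 1
    simp [hπ0]
  have hunit : ∀ x, χ γ x ≠ 1 → abs ((x.toAdd : F) : E) = 1 := by
    intro x hx
    by_contra hne
    apply hx
    have hle : abs ((x.toAdd : F) : E) ≤ 1 := x.toAdd.2
    rw [hχ, hcongr _ _ (hout γ) _ hle]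
    apply hψO
    push_cast
    rw [abs.map_mul, map_inv₀, inv_mul_le_iff₀ hπpos, mul_one]
    by_cases h0 : (x.toAdd : F) = 0
    · rw [h0]
      simp
    · obtain ⟨k, hk⟩ := hdisc _ h0
      rw [hk] at hle hne ⊢
      have hk1 : 1 ≤ k := by
        by_contra hk0
        rcases (by omega : k = 0 ∨ k < 0) with rfl | hk0
        · simp at hne
        · exact absurd hle (not_le.mpr (one_lt_zpow_of_neg₀ hπpos hπ1 hk0))
      simpa using zpow_le_zpow_right_of_le_one₀ hπpos hπ1.le hk1
  have main : ¬ ∃ C : ℤ → Wq E abs na F → Vτ,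
      IsExpansionOf E abs na F π ψ Vτ C (fun x : F => if abs (x : E) = 1 then Cv else 0) ∧
      ∀ β : Wq E abs na F, C 0 β ∈ M0 β := by
    rintro ⟨C, ⟨-, hfin, hexp⟩, hC⟩
    have hCv' : Cv = C 0 0 - C 0 γ := by
      refine eq_sub_of_sum_eq_const χ hinj hadd hγ0 (C 0) (hfin 0) Cv fun x hx => ?_
      simpa [hunit x hx, hχ] using hexp 0 x.toAdd (by simpa using hunit x hx)
    refine hCv ⟨{0, γ}, fun β => if β = 0 then C 0 0 else -C 0 γ, ?_, ?_, ?_⟩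
    · simp [hγ1]
    · simp [hγ0, hC 0, (hM0 γ).neg_mem (hC γ)]
    · rw [Finset.sum_pair hγ0.symm]
      simp [hγ0, hCv', sub_eq_add_neg]
  refine ⟨main, fun V0 hV0 hmem => main (hV0 _ hmem fun x hx => ?_)⟩
  simp [hx.ne']

end BS
end
end
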